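/- arXiv:1906.11650 — 2 statements merged into one kernel-verified Lean document; each statement's English description precedes it below -/
import Mathlib

section
/- Let F be a field with at least 4 elements and v : F^× → ℤ a surjective discrete valuation with residue field k. Then the specialization homomorphism induces isomorphisms of R_F-modules (RP′(F)[1/2])_{χ_v} ≅ (Ind_F^k RP′(k)[1/2])_{χ_v} ≅ P(k)[1/2]{v}. -/
open scoped Classical

noncomputable section

variable (F : Type) [Field F]

/-- The group of square classes `G_F = F^× / (F^×)²`. -/
def SqCl (F : Type) [Field F] : Type :=
  Fˣ ⧸ (powMonoidHom 2 : Fˣ →* Fˣ).range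

instance : CommGroup (SqCl F) := QuotientGroup.Quotient.commGroup _

/-- The square class of a unit. -/
def sqc : Fˣ →* SqCl F := QuotientGroup.mk' _

/-- The group ring `R_F = ℤ[F^×/(F^×)²]`. -/
abbrev RF (F : Type) [Field F] : Type := MonoidAlgebra ℤ (SqCl F)

/-- `⟨x⟩ ∈ R_F`, the square class of a unit as an element of the group ring. -/
def cls (x : Fˣ) : RF F := MonoidAlgebra.of ℤ (SqCl F) (sqc F x)

/-- The free `R_F`-module on the set `F^×`. -/
abbrev FreeRP (F : Type) [Field F] : Type := Fˣ →₀ RF F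

/-- The generator `[x]` of the free module. -/
def gen (x : Fˣ) : FreeRP F := Finsupp.single x 1

/-- units from nonzero field elements -/
def U (x : F) (h : x ≠ 0) : Fˣ := Units.mk0 x h

variable {F}

theorem one_sub_ne {x : Fˣ} (hx : (x : F) ≠ 1) : (1 : F) - x ≠ 0 :=
  sub_ne_zero.mpr (Ne.symm hx)

theorem inv_sub_one_ne {x : Fˣ} (hx : (x : F) ≠ 1) : ((x : F)⁻¹ - 1) ≠ 0 :=
  sub_ne_zero.mpr (fun h => hx (by rwa [inv_eq_one] at h))

theorem one_sub_inv_ne {x : Fˣ} (hx : (x : F) ≠ 1) : (1 - (x : F)⁻¹) ≠ 0 :=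
  sub_ne_zero.mpr (fun h => hx (by rw [eq_comm, inv_eq_one] at h; exact h.symm ▸ rfl))

variable (F)

/-- The five term relation `S_{x,y}` as an element of the free module. -/
def FT (x y : Fˣ) (hx : (x : F) ≠ 1) (hy : (y : F) ≠ 1) : FreeRP F :=
  gen F x - gen F y + cls F x • gen F (y * x⁻¹)
    - cls F (U F ((x : F)⁻¹ - 1) (inv_sub_one_ne hx)) •
        gen F (U F ((1 - (x : F)⁻¹) / (1 - (y : F)⁻¹))
          (div_ne_zero (one_sub_inv_ne hx) (one_sub_inv_ne hy)))
    + cls F (U F (1 - (x : F)) (one_sub_ne hx)) •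
        gen F (U F ((1 - (x : F)) / (1 - (y : F)))
          (div_ne_zero (one_sub_ne hx) (one_sub_ne hy)))

/-- The set of five-term relations. -/
def ftRels : Set (FreeRP F) :=
  {w | ∃ (x y : Fˣ) (hx : (x : F) ≠ 1) (hy : (y : F) ≠ 1), w = FT F x y hx hy}

/-- The relations `ψ₁(x) = [x] + ⟨-1⟩[x⁻¹]`. -/
def psiRels : Set (FreeRP F) :=
  {w | ∃ x : Fˣ, w = gen F x + cls F (-1) • gen F x⁻¹}

/-- relations `⟨-1⟩[x] = [x]` -/
def minusRels : Set (FreeRP F) :=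
  {w | ∃ x : Fˣ, w = cls F (-1) • gen F x - gen F x}

/-- relations `[x⁻¹] = -[x]` -/
def invRels : Set (FreeRP F) :=
  {w | ∃ x : Fˣ, w = gen F x⁻¹ + gen F x}

/-- The module `qRP(F) = RP(F)/⟨ψ₁(x) : x ∈ F^×⟩`. -/
def qRP : Type := FreeRP F ⧸ Submodule.span (RF F) (ftRels F ∪ psiRels F)

instance : AddCommGroup (qRP F) := by unfold qRP; infer_instance
instance : Module (RF F) (qRP F) := by unfold qRP; infer_instance

/-- `[x] ∈ qRP(F)` -/
def qrp (x : Fˣ) : qRP F := Submodule.Quotient.mk (gen F x)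

/-- The module `RP′(F)`. -/
def RP' : Type :=
  FreeRP F ⧸ Submodule.span (RF F)
    ({gen F 1} ∪ ftRels F ∪ minusRels F ∪ invRels F)

instance : AddCommGroup (RP' F) := by unfold RP'; infer_instance
instance : Module (RF F) (RP' F) := by unfold RP'; infer_instance

/-- `[x] ∈ RP′(F)` -/
def rp (x : Fˣ) : RP' F := Submodule.Quotient.mk (gen F x)

/-- the submodule of `M` generated by the elements `(⟨a⟩ - χ(a))·m`. -/
def chiSub (χ : SqCl F →* ℤˣ) (M : Type) [AddCommGroup M] [Module (RF F) M] :
    Submodule (RF F) M :=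
  Submodule.span (RF F)
    {w | ∃ (a : Fˣ) (m : M), w = cls F a • m - ((χ (sqc F a) : ℤ)) • m}

/-- `M_χ` -/
def ChiQuot (χ : SqCl F →* ℤˣ) (M : Type) [AddCommGroup M] [Module (RF F) M] : Type :=
  M ⧸ chiSub F χ M

instance (χ : SqCl F →* ℤˣ) (M : Type) [AddCommGroup M] [Module (RF F) M] :
    AddCommGroup (ChiQuot F χ M) := by unfold ChiQuot; infer_instance
instance (χ : SqCl F →* ℤˣ) (M : Type) [AddCommGroup M] [Module (RF F) M] :
    Module (RF F) (ChiQuot F χ M) := by unfold ChiQuot; infer_instance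

/-- image of `m` in `M_χ` -/
def mkChi (χ : SqCl F →* ℤˣ) {M : Type} [AddCommGroup M] [Module (RF F) M] (m : M) :
    ChiQuot F χ M := Submodule.Quotient.mk m

/-- `M[1/2]`, as an `R_F`-module (localization at the powers of `2`). -/
def Loc2 (M : Type) [AddCommGroup M] [Module (RF F) M] : Type :=
  LocalizedModule (Submonoid.powers (2 : RF F)) M

instance (M : Type) [AddCommGroup M] [Module (RF F) M] : AddCommGroup (Loc2 F M) := by
  unfold Loc2; infer_instance
instance (M : Type) [AddCommGroup M] [Module (RF F) M] : Module (RF F) (Loc2 F M) := by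
  unfold Loc2; infer_instance

/-- the canonical map `M → M[1/2]` -/
def toLoc2 {M : Type} [AddCommGroup M] [Module (RF F) M] (m : M) : Loc2 F M :=
  LocalizedModule.mkLinearMap (Submonoid.powers (2 : RF F)) M m


/-- the square class of a field element (junk value `1` at `0`). -/
def sqv (a : F) : SqCl F := if h : a ≠ 0 then sqc F (U F a h) else 1

/-- `[a] ∈ RP′(F)` for a field element `a`, where `[0]` is assigned the value `c₀`. -/
def rpc (c₀ : RP' F) (a : F) : RP' F := if h : a ≠ 0 then rp F (U F a h) else c₀


section PreBloch

variable (k : Type) [Field k]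

/-- The plain five-term relation in the free abelian group on `k^×`. -/
def FTZ (x y : kˣ) (hx : (x : k) ≠ 1) (hy : (y : k) ≠ 1) : kˣ →₀ ℤ :=
  Finsupp.single x 1 - Finsupp.single y 1 + Finsupp.single (y * x⁻¹) 1
    - Finsupp.single (U k ((1 - (x : k)⁻¹) / (1 - (y : k)⁻¹))
        (div_ne_zero (one_sub_inv_ne hx) (one_sub_inv_ne hy))) 1
    + Finsupp.single (U k ((1 - (x : k)) / (1 - (y : k)))
        (div_ne_zero (one_sub_ne hx) (one_sub_ne hy))) 1

/-- The pre-Bloch (scissors congruence) group `P(k)`: generators `[x]`, `x ∈ k^×`,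
relations `[1] = 0` and the five-term relations. -/
def PBloch : Type :=
  (kˣ →₀ ℤ) ⧸ Submodule.span ℤ
    ({Finsupp.single (1 : kˣ) (1 : ℤ)} ∪
      {w | ∃ (x y : kˣ) (hx : (x : k) ≠ 1) (hy : (y : k) ≠ 1), w = FTZ k x y hx hy})

instance : AddCommGroup (PBloch k) := by unfold PBloch; infer_instance

/-- `[x] ∈ P(k)` -/
def pb (x : kˣ) : PBloch k := Submodule.Quotient.mk (Finsupp.single x 1)

end PreBloch

section Conventions

variable (k : Type) [Field k]

/-- The augmentation `R_F → ℤ`. -/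
def augRF : RF k →+* ℤ := ((MonoidAlgebra.lift ℤ ℤ (SqCl k)) 1).toRingHom

/-- The augmentation ideal `I_F ⊆ R_F`. -/
def augIdeal : Ideal (RF k) := RingHom.ker (augRF k)

/-- the trivial `R_k`-module structure on an abelian group -/
def trivMod (M : Type) [AddCommGroup M] : Module (RF k) M := Module.compHom _ (augRF k)

/-- `RP′(F₃)`: the appropriate quotient of the cyclic `R_{F₃}`-module generated by
`[-1]` with the relation `2([-1] + ⟨-1⟩[-1]) = 0`. -/
def RP'3 : Type :=
  RF k ⧸ Submodule.span (RF k)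
    {(2 : RF k) * (1 + cls k (-1)), cls k (-1) - 1, 1 + cls k (-1)}

instance : AddCommGroup (RP'3 k) := by unfold RP'3; infer_instance
instance : Module (RF k) (RP'3 k) := by unfold RP'3; infer_instance

/-- `qRP(F₃) = RP(F₃)/⟨ψ₁⟩`, where `RP(F₃)` is the cyclic `R_{F₃}`-module generated
by `[-1]` with the relation `2([-1] + ⟨-1⟩[-1]) = 0`. -/
def qRP3 : Type :=
  RF k ⧸ Submodule.span (RF k) {(2 : RF k) * (1 + cls k (-1)), 1 + cls k (-1)}

instance : AddCommGroup (qRP3 k) := by unfold qRP3; infer_instance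
instance : Module (RF k) (qRP3 k) := by unfold qRP3; infer_instance

/-- `RP′(k)` (bundled), with the conventions for the fields with `2` and `3`
elements:  for `|k| = 2` it is `ℤ/3` with the trivial `R_k`-action, and for
`|k| = 3` it is the module `RP'3 k` above. -/
noncomputable def RP'Kb : ModuleCat (RF k) :=
  if Nat.card k = 2 then (letI := trivMod k (ZMod 3); ModuleCat.of (RF k) (ZMod 3))
  else if Nat.card k = 3 then ModuleCat.of (RF k) (RP'3 k)
  else ModuleCat.of (RF k) (RP' k)

/-- `RP′(k)`, with the conventions for the fields with `2` and `3` elements. -/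
noncomputable abbrev RP'K : Type := (RP'Kb k).carrier

/-- the generators `[u]`, `u ∈ k^×`, of `RP′(k)` (with the small-field conventions;
for `|k| = 2` one has `[1] = 0`, and for `|k| = 3`, `[1] = 0` and `[-1]` is the
distinguished generator) -/
noncomputable def rpK : kˣ → RP'K k := by
  unfold RP'K RP'Kb
  by_cases h2 : Nat.card k = 2
  · rw [if_pos h2]; exact fun _ => 0
  · rw [if_neg h2]
    by_cases h3 : Nat.card k = 3
    · rw [if_pos h3]
      exact fun u => if (u : k) = 1 then 0 else Submodule.Quotient.mk (1 : RF k)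
    · rw [if_neg h3]; exact rp k

/-- `qRP(k)` (bundled), with the conventions for the fields with `2` and `3`
elements. -/
noncomputable def qRPKb : ModuleCat (RF k) :=
  if Nat.card k = 2 then (letI := trivMod k (ZMod 3); ModuleCat.of (RF k) (ZMod 3))
  else if Nat.card k = 3 then ModuleCat.of (RF k) (qRP3 k)
  else ModuleCat.of (RF k) (qRP k)

/-- `qRP(k)`, with the conventions for the fields with `2` and `3` elements. -/
noncomputable abbrev qRPK : Type := (qRPKb k).carrier

/-- the generators `[u]`, `u ∈ k^×`, of `qRP(k)` (with the small-field conventions) -/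
noncomputable def qrpK : kˣ → qRPK k := by
  unfold qRPK qRPKb
  by_cases h2 : Nat.card k = 2
  · rw [if_pos h2]; exact fun _ => 0
  · rw [if_neg h2]
    by_cases h3 : Nat.card k = 3
    · rw [if_pos h3]
      exact fun u => if (u : k) = 1 then 0 else Submodule.Quotient.mk (1 : RF k)
    · rw [if_neg h3]; exact qrp k

/-- The scissors congruence group `P(k)`, with the conventions for the fields with
`2` and `3` elements (`P(F₂) = ℤ/3` and `P(F₃) = ℤ/4`, generated by `[-1]`). -/
def PBK : Type :=
  if Nat.card k = 2 then ZMod 3 else if Nat.card k = 3 then ZMod 4 else PBloch k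

noncomputable instance : AddCommGroup (PBK k) := by
  unfold PBK; split
  · infer_instance
  · split <;> infer_instance

/-- the generators `[u]`, `u ∈ k^×`, of `P(k)` (with the small-field conventions) -/
noncomputable def pbK' : kˣ → PBK k := by
  unfold PBK
  by_cases h2 : Nat.card k = 2
  · rw [if_pos h2]; exact fun _ => 0
  · rw [if_neg h2]
    by_cases h3 : Nat.card k = 3
    · rw [if_pos h3]
      exact fun u => if (u : k) = 1 then 0 else (1 : ZMod 4)
    · rw [if_neg h3]; exact pb k

end Conventions

section ValuedField

variable (F : Type) [Field F] {Γ₀ : Type} [LinearOrderedCommGroupWithZero Γ₀]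
variable (v : Valuation F Γ₀)

/-- The residue field `k(v)` of the valuation ring of `v`. -/
def Resk : Type := IsLocalRing.ResidueField ↥v.valuationSubring

instance : Field (Resk F v) := by unfold Resk; infer_instance

/-- the unit group `U_v` of the valuation ring -/
def Uv : Type := (↥v.valuationSubring)ˣ

instance : CommGroup (Uv F v) := by unfold Uv; infer_instance

/-- `ℤ[U_v]` -/
def ZU : Type := MonoidAlgebra ℤ (Uv F v)

instance : CommRing (ZU F v) := by unfold ZU; infer_instance

/-- `U_v →* F^×` -/
def uvToUnits : Uv F v →* Fˣ := Units.map (v.valuationSubring.subtype).toMonoidHom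

/-- `U_v →* k^×` (reduction modulo the maximal ideal) -/
def uvToResUnits : Uv F v →* (Resk F v)ˣ :=
  Units.map (IsLocalRing.residue ↥v.valuationSubring).toMonoidHom

/-- `ℤ[U_v] → R_F` -/
def zuF : ZU F v →+* RF F :=
  MonoidAlgebra.mapDomainRingHom ℤ ((sqc F).comp (uvToUnits F v))

/-- `ℤ[U_v] → R_{k(v)}` -/
def zuK : ZU F v →+* RF (Resk F v) :=
  MonoidAlgebra.mapDomainRingHom ℤ ((sqc (Resk F v)).comp (uvToResUnits F v))

/-- `Ind_F^k M = R_F ⊗_{ℤ[U_v]} M` for an `R_k`-module `M`. -/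
def IndMod (M : Type) [AddCommGroup M] [Module (RF (Resk F v)) M] : Type :=
  @TensorProduct (ZU F v) _ (RF F) M _ _
    (Module.compHom _ (zuF F v)) (Module.compHom _ (zuK F v))

noncomputable instance (M : Type) [AddCommGroup M] [Module (RF (Resk F v)) M] :
    AddCommGroup (IndMod F v M) := by
  unfold IndMod
  letI : Module (ZU F v) (RF F) := Module.compHom _ (zuF F v)
  letI : Module (ZU F v) M := Module.compHom _ (zuK F v)
  infer_instance

noncomputable instance (M : Type) [AddCommGroup M] [Module (RF (Resk F v)) M] :
    Module (RF F) (IndMod F v M) := by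
  unfold IndMod
  letI : Module (ZU F v) (RF F) := Module.compHom _ (zuF F v)
  letI : Module (ZU F v) M := Module.compHom _ (zuK F v)
  letI : SMulCommClass (ZU F v) (RF F) (RF F) :=
    ⟨fun r s t => by
      show zuF F v r * (s * t) = s * (zuF F v r * t)
      ring⟩
  exact TensorProduct.leftModule

/-- the element `r ⊗ m` of `Ind_F^k M` -/
noncomputable def indE (M : Type) [AddCommGroup M] [Module (RF (Resk F v)) M]
    (r : RF F) (m : M) : IndMod F v M :=
  letI : Module (ZU F v) (RF F) := Module.compHom _ (zuF F v)
  letI : Module (ZU F v) M := Module.compHom _ (zuK F v)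
  r ⊗ₜ[ZU F v] m

/-- a unit of `F` of valuation `1` gives a unit of the valuation ring -/
def unitOfVal (x : Fˣ) (hx : v (x : F) = 1) : Uv F v :=
  { val := ⟨(x : F), le_of_eq hx⟩
    inv := ⟨((x : F)⁻¹),
      by
        rw [Valuation.mem_valuationSubring_iff, map_inv₀, hx, inv_one]⟩
    val_inv := by
      apply Subtype.ext
      simp [mul_inv_cancel₀ (Units.ne_zero x)]
    inv_val := by
      apply Subtype.ext
      simp [inv_mul_cancel₀ (Units.ne_zero x)] }

/-- the image in `k(v)^×` of a unit of `F` of valuation `1` -/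
def resUnit (x : Fˣ) (hx : v (x : F) = 1) : (Resk F v)ˣ :=
  uvToResUnits F v (unitOfVal F v x hx)

end ValuedField

section DiscreteValuationChar

variable (F : Type) [Field F]

/-- The character `χ_v : G_F → {±1}`, `⟨a⟩ ↦ (-1)^{v(a)}`, associated to a
homomorphism `v : F^× → ℤ`. -/
def chiV (v : Fˣ → ℤ) (hv : ∀ x y : Fˣ, v (x * y) = v x + v y) : SqCl F →* ℤˣ :=
  QuotientGroup.lift _
    { toFun := fun x => (-1 : ℤˣ) ^ (v x)
      map_one' := by
        have h1 : v 1 = v 1 + v 1 := by simpa using (hv 1 1).symm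
        have h0 : v 1 = 0 := by omega
        simp [h0]
      map_mul' := fun x y => by simp only [hv, zpow_add] }
    (by
      rintro w ⟨y, rfl⟩
      show (-1 : ℤˣ) ^ (v (y ^ 2)) = 1
      have : v (y ^ 2) = v y + v y := by rw [pow_two]; exact hv y y
      rw [this, zpow_add]
      exact Int.units_mul_self _)

/-- The set `U_n = 1 + M_v^n ⊆ F^×` for a discrete valuation `v`. -/
def UnSet (v : Fˣ → ℤ) (n : ℕ) : Set Fˣ :=
  {u : Fˣ | (u : F) = 1 ∨ ∃ h : (u : F) - 1 ≠ 0, (n : ℤ) ≤ v (U F ((u : F) - 1) h)}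

end DiscreteValuationChar

section DiscreteValuationZ

variable (F : Type) [Field F]

/-- the additive value `v(x) ∈ ℤ` of a unit, for a (multiplicatively written)
valuation `v : F → ℤₘ₀` -/
def vzk (v : Valuation F (WithZero (Multiplicative ℤ))) (x : Fˣ) : ℤ :=
  - Multiplicative.toAdd (WithZero.unzero ((Valuation.ne_zero_iff v).mpr (Units.ne_zero x)))

theorem vzk_mul (v : Valuation F (WithZero (Multiplicative ℤ))) (x y : Fˣ) :
    vzk F v (x * y) = vzk F v x + vzk F v y := by
  have h1 : v ((↑(x * y) : F)) ≠ 0 := (Valuation.ne_zero_iff v).mpr (Units.ne_zero (x * y))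
  have h2 : v ((x : F)) ≠ 0 := (Valuation.ne_zero_iff v).mpr (Units.ne_zero x)
  have h3 : v ((y : F)) ≠ 0 := (Valuation.ne_zero_iff v).mpr (Units.ne_zero y)
  have key : WithZero.unzero h1 = WithZero.unzero h2 * WithZero.unzero h3 := by
    rw [← WithZero.coe_inj, WithZero.coe_mul, WithZero.coe_unzero, WithZero.coe_unzero,
      WithZero.coe_unzero, Units.val_mul, map_mul]
  unfold vzk
  show -Multiplicative.toAdd (WithZero.unzero h1) =
      -Multiplicative.toAdd (WithZero.unzero h2) + -Multiplicative.toAdd (WithZero.unzero h3)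
  rw [key, toAdd_mul]
  ring

/-- the character `χ_v` of a (surjective) discrete valuation `v : F → ℤₘ₀` -/
def chiVal (v : Valuation F (WithZero (Multiplicative ℤ))) : SqCl F →* ℤˣ :=
  chiV F (vzk F v) (vzk_mul F v)

/-- The subset `U_n = 1 + M_v^n` of `F^×`, for a surjective discrete valuation
`v : F → ℤₘ₀`:  the units `u` with `v(u - 1) ≥ n` (additively). -/
def UnV (v : Valuation F (WithZero (Multiplicative ℤ))) (n : ℕ) : Set Fˣ :=
  {u : Fˣ | ∀ h : (u : F) - 1 ≠ 0, (n : ℤ) ≤ vzk F v (U F ((u : F) - 1) h)}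

end DiscreteValuationZ

section KvMathlib

variable (F : Type) [Field F] {Γ₀ : Type} [LinearOrderedCommGroupWithZero Γ₀]

/-- `1 + M_v ⊆ F^×` -/
def U1V (v : Valuation F Γ₀) : Set Fˣ := {u : Fˣ | v ((u : F) - 1) < 1}

/-- `K_v ⊆ qRP(F)`: the `R_F`-submodule generated by the `[u]` with `u ∈ 1 + M_v`. -/
def KvV (v : Valuation F Γ₀) : Submodule (RF F) (qRP F) :=
  Submodule.span (RF F) (qrp F '' U1V F v)

end KvMathlib

/-- the canonical map `M → M[1/2]` (localization of a `ℤ`-module away from `2`) -/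
def toLocZ (M : Type) [AddCommGroup M] (m : M) :
    LocalizedModule (Submonoid.powers (2 : ℤ)) M :=
  LocalizedModule.mkLinearMap (Submonoid.powers (2 : ℤ)) M m

end


theorem kv_key (F : Type) [Field F] (ord : F → ℤ)
    (hmul : ∀ x y : F, x ≠ 0 → y ≠ 0 → ord (x * y) = ord x + ord y)
    (hsub : ∀ x : F, x ≠ 0 → 0 < ord x → ord (1 - x) = 0 ∧ (1 - x) ≠ 0)
    (pi : F) (hpi0 : pi ≠ 0) (hpi : ord pi = 1)
    (X : Type) [AddCommGroup X] (h2 : ∀ z : X, z + z = 0 → z = 0)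
    (s : F → ℤ) (hse : ∀ x, x ≠ 0 → Even (ord x) → s x = 1)
    (hso : ∀ x, x ≠ 0 → Odd (ord x) → s x = -1)
    (B : F → X) (hinv : ∀ x, x ≠ 0 → B x⁻¹ = - B x) (B1 : B 1 = 0)
    (five : ∀ x y : F, x ≠ 0 → x ≠ 1 → y ≠ 0 → y ≠ 1 →
      B x - B y + s x • B (y / x) - s (x⁻¹ - 1) • B ((1 - x⁻¹) / (1 - y⁻¹))
        + s (1 - x) • B ((1 - x) / (1 - y)) = 0) :
    ∃ c : X, (∀ x, x ≠ 0 → x ≠ 1 → B x + B (1 - x) = c) ∧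
      (∀ x, x ≠ 0 → 0 < ord x → B x = c) ∧
      (∀ x, x ≠ 0 → 0 < ord x → B (1 - x) = 0) ∧ (3 : ℤ) • c = 0 := by
  have ord1 : ord 1 = 0 := by
    have := hmul 1 1 one_ne_zero one_ne_zero
    simp at this; exact this
  have ordinv : ∀ x, x ≠ 0 → ord x⁻¹ = - ord x := by
    intro x hx
    have := hmul x x⁻¹ hx (inv_ne_zero hx)
    rw [mul_inv_cancel₀ hx, ord1] at this; omega
  have orddiv : ∀ x y, x ≠ 0 → y ≠ 0 → ord (x / y) = ord x - ord y := by
    intro x y hx hy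
    rw [div_eq_mul_inv, hmul x _ hx (inv_ne_zero hy), ordinv y hy]; omega
  have ordm1 : ord (-1) = 0 := by
    have := hmul (-1) (-1) (by simp) (by simp)
    simp [ord1] at this; omega
  have ordneg : ∀ x, x ≠ 0 → ord (-x) = ord x := by
    intro x hx
    rw [neg_eq_neg_one_mul, hmul _ _ (by simp) hx, ordm1]; omega
  have sord : ∀ x y, x ≠ 0 → y ≠ 0 → Even (ord x - ord y) → s x = s y := by
    intro x y hx hy h
    rcases Int.even_or_odd (ord x) with hx' | hx'
    · rw [hse x hx hx', hse y hy (by grind)]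
    · rw [hso x hx hx', hso y hy (by grind)]
  have posne1 : ∀ x, 0 < ord x → x ≠ 1 := by
    rintro x h rfl; omega
  have hdinv : ∀ x y, x ≠ 0 → y ≠ 0 → B (x / y) = - B (y / x) := by
    intro x y hx hy
    rw [← hinv _ (div_ne_zero hy hx), inv_div]
  have sub1 : ∀ x : F, x ≠ 1 → 1 - x ≠ 0 := fun x hx h => hx (by linear_combination -h)
  -- constancy of C
  have hC : ∀ x y, x ≠ 0 → x ≠ 1 → y ≠ 0 → y ≠ 1 → B x + B (1 - x) = B y + B (1 - y) := by
    intro x y hx hx1 hy hy1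
    have ux := sub1 x hx1
    have uy := sub1 y hy1
    have e1 := five x y hx hx1 hy hy1
    have e2 := five (1 - x) (1 - y) ux (by simpa using hx) uy (by simpa using hy)
    have a1 : s ((1 - x)⁻¹ - 1) = s (x⁻¹ - 1) := by
      have p1 : (1 - x)⁻¹ - 1 = x / (1 - x) := by field_simp; ring
      have p2 : x⁻¹ - 1 = (1 - x) / x := by field_simp
      rw [p1, p2]
      apply sord _ _ (div_ne_zero hx ux) (div_ne_zero ux hx)
      rw [orddiv _ _ hx ux, orddiv _ _ ux hx]
      exact ⟨ord x - ord (1 - x), by ring⟩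
    have ux' : x⁻¹ - 1 ≠ 0 := by
      intro h; apply ux; field_simp at h; linear_combination h
    have uy' : y⁻¹ - 1 ≠ 0 := by
      intro h; apply uy; field_simp at h; linear_combination h
    have ux2 : 1 - x⁻¹ ≠ 0 := by
      intro h; apply ux'; linear_combination -h
    have uy2 : 1 - y⁻¹ ≠ 0 := by
      intro h; apply uy'; linear_combination -h
    have a2 : B ((1 - (1 - x)⁻¹) / (1 - (1 - y)⁻¹)) = - B ((1 - x⁻¹) / (1 - y⁻¹)) := by
      rw [← hdinv _ _ uy2 ux2]
      congr 1
      have q1 : (1 - (1 - x)⁻¹) = (1 - x⁻¹)⁻¹ := by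
        have : x - 1 ≠ 0 := by intro h; apply ux; linear_combination -h
        have p : 1 - x⁻¹ = (x - 1) / x := by field_simp
        rw [p, inv_div]; field_simp; ring
      have q2 : (1 - (1 - y)⁻¹) = (1 - y⁻¹)⁻¹ := by
        have : y - 1 ≠ 0 := by intro h; apply uy; linear_combination -h
        have p : 1 - y⁻¹ = (y - 1) / y := by field_simp
        rw [p, inv_div]; field_simp; ring
      rw [q1, q2, div_eq_mul_inv, inv_inv, div_eq_mul_inv, mul_comm]
    rw [a1, a2, sub_sub_cancel, sub_sub_cancel, hdinv x y hx hy, hdinv (1 - y) (1 - x) uy ux] at e2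
    rw [← sub_eq_zero]
    have e3 := congrArg₂ (· + ·) e1 e2
    simp only [smul_neg, add_zero] at e3
    rw [← e3]; abel
  -- generic five term rewriting for ord x > 0
  have posfacts : ∀ x, x ≠ 0 → 0 < ord x → s (1 - x) = 1 ∧ s (x⁻¹ - 1) = s x := by
    intro x hx h
    obtain ⟨o, n⟩ := hsub x hx h
    refine ⟨hse _ n (by rw [o]; exact Even.zero), ?_⟩
    have p2 : x⁻¹ - 1 = (1 - x) / x := by field_simp
    rw [p2]
    apply sord _ _ (div_ne_zero n hx) hx
    rw [orddiv _ _ n hx, o]; exact ⟨- ord x, by ring⟩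
  have L1a : ∀ x y, x ≠ 0 → y ≠ 0 → 0 < ord x → 0 < ord y → Odd (ord x) → Even (ord y) →
      B ((y / x) * ((1 - x) / (1 - y))) = B (y / x) := by
    intro x y hx hy px py ox ey
    have ux := (hsub x hx px).2
    have uy := (hsub y hy py).2
    have e1 := five x y hx (posne1 x px) hy (posne1 y py)
    have e2 := five y x hy (posne1 y py) hx (posne1 x px)
    rw [(posfacts x hx px).1, (posfacts x hx px).2, hso x hx ox] at e1
    rw [(posfacts y hy py).1, (posfacts y hy py).2, hse y hy ey] at e2
    have a1 : (1 - x⁻¹) / (1 - y⁻¹) = (y / x) * ((1 - x) / (1 - y)) := by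
      have : y - 1 ≠ 0 := by intro h; apply uy; linear_combination -h
      have p : 1 - y⁻¹ = (y - 1) / y := by field_simp
      rw [p]; field_simp; ring
    have a2 : (1 - y⁻¹) / (1 - x⁻¹) = ((y / x) * ((1 - x) / (1 - y)))⁻¹ := by
      rw [← a1, inv_div]
    rw [a1] at e1
    rw [a2, hinv _ (mul_ne_zero (div_ne_zero hy hx) (div_ne_zero ux uy)),
      hdinv x y hx hy, hdinv (1 - y) (1 - x) uy ux] at e2
    rw [← sub_eq_zero]
    apply h2
    have e3 := congrArg₂ (· + ·) e1 e2
    simp only [smul_neg, add_zero, neg_smul, one_smul] at e3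
    rw [← e3]; abel
  have L1 : ∀ x y, x ≠ 0 → y ≠ 0 → 0 < ord x → 0 < ord y → Odd (ord y - ord x) →
      B ((y / x) * ((1 - x) / (1 - y))) = B (y / x) := by
    intro x y hx hy px py o
    have ux := (hsub x hx px).2
    have uy := (hsub y hy py).2
    rcases Int.even_or_odd (ord x) with h | h
    · have := L1a y x hy hx py px (by grind) h
      rw [hdinv x y hx hy] at this
      have e : (y / x) * ((1 - x) / (1 - y)) = ((x / y) * ((1 - y) / (1 - x)))⁻¹ := by
        rw [mul_inv, inv_div, inv_div]
      rw [e, hinv _ (mul_ne_zero (div_ne_zero hx hy) (div_ne_zero uy ux)), this, neg_neg]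
    · exact L1a x y hx hy px py h (by grind)
  have L2 : ∀ z t, z ≠ 0 → 0 < ord z → Odd (ord z) → t ≠ 0 → 0 < ord t →
      B (z * (1 - t)) = B z := by
    intro z t hz pz oz ht pt
    obtain ⟨o1, n1⟩ := hsub t ht pt
    have hzt : (1 - t) * z ≠ 0 := mul_ne_zero n1 hz
    have ozt : ord ((1 - t) * z) = ord z := by rw [hmul _ _ n1 hz, o1]; omega
    obtain ⟨o2, n2⟩ := hsub _ hzt (by omega)
    obtain ⟨o3, n3⟩ := hsub _ hz pz
    have ox : ord (t / (1 - (1 - t) * z)) = ord t := by rw [orddiv _ _ ht n2, o2]; omega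
    have hx : t / (1 - (1 - t) * z) ≠ 0 := div_ne_zero ht n2
    have oy : ord (z * (t / (1 - (1 - t) * z))) = ord z + ord t := by rw [hmul _ _ hz hx, ox]
    have hy := mul_ne_zero hz hx
    have := L1 _ _ hx hy (by omega) (by omega) (by rw [oy, ox]; simpa using oz)
    have e1 : z * (t / (1 - (1 - t) * z)) / (t / (1 - (1 - t) * z)) = z :=
      mul_div_cancel_right₀ _ hx
    have e2 : (1 - t / (1 - (1 - t) * z)) / (1 - z * (t / (1 - (1 - t) * z))) = 1 - t := by
      obtain ⟨D, hD⟩ : ∃ D, D = 1 - (1 - t) * z := ⟨_, rfl⟩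
      rw [← hD] at n2 ⊢
      have p1 : 1 - t / D = (1 - t) * (1 - z) / D := by
        field_simp; rw [hD]; ring
      have p2 : 1 - z * (t / D) = (1 - z) / D := by
        field_simp; rw [hD]; ring
      rw [p1, p2]; field_simp
    rw [e1, e2] at this
    exact this
  have L2' : ∀ z t, z ≠ 0 → 0 < ord z → Odd (ord z) → t ≠ 0 → 0 < ord t →
      B (z / (1 - t)) = B z := by
    intro z t hz pz oz ht pt
    obtain ⟨o1, n1⟩ := hsub t ht pt
    have hz' := div_ne_zero hz n1
    have := L2 (z / (1 - t)) t hz' (by rw [orddiv _ _ hz n1]; omega)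
      (by rw [orddiv _ _ hz n1, o1]; simpa using oz) ht pt
    rw [div_mul_cancel₀ _ n1] at this
    exact this.symm
  obtain ⟨c, hc⟩ : ∃ c, ∀ x, x ≠ 0 → x ≠ 1 → B x + B (1 - x) = c :=
    ⟨B pi + B (1 - pi), fun x hx hx1 => hC x pi hx hx1 hpi0 (posne1 pi (by omega))⟩
  -- the basic relation
  have L3 : ∀ x t, x ≠ 0 → t ≠ 0 → 0 < ord x → 0 < ord t → Odd (ord x) →
      B x + B x + B t - c - B (x / (1 - x) * (t / (1 - t))) - B (t / (1 - x)) = 0 := by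
    intro x t hx ht px pt ox
    obtain ⟨o1, n1⟩ := hsub x hx px
    obtain ⟨o2, n2⟩ := hsub t ht pt
    have e1 := five x (1 - t) hx (posne1 x px) n2 (by simpa using ht)
    rw [(posfacts x hx px).1, (posfacts x hx px).2, hso x hx ox, sub_sub_cancel,
      hdinv _ _ n2 hx, L2' x t hx px ox ht pt, hdinv _ _ n1 ht] at e1
    have n1' : 1 - x⁻¹ ≠ 0 := by
      intro h; apply n1; field_simp at h; linear_combination -h
    have n2' : 1 - (1 - t)⁻¹ ≠ 0 := by
      intro h; apply ht; field_simp at h; linear_combination -h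
    have a : (1 - (1 - t)⁻¹) / (1 - x⁻¹) = x / (1 - x) * (t / (1 - t)) := by
      have : x - 1 ≠ 0 := by intro h; apply n1; linear_combination -h
      have p : 1 - x⁻¹ = (x - 1) / x := by field_simp
      rw [p]; field_simp; ring
    rw [hdinv _ _ n1' n2', a] at e1
    have e2 := hc t ht (posne1 t pt)
    rw [← e2, ← e1]
    simp only [smul_neg, neg_smul, one_smul, neg_neg]
    abel
  have L4 : ∀ x, x ≠ 0 → 0 < ord x → Odd (ord x) → B x = B pi := by
    intro x hx px ox
    have ppi : 0 < ord pi := by omega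
    have opi : Odd (ord pi) := by rw [hpi]; exact odd_one
    have e1 := L3 x pi hx hpi0 px ppi ox
    have e2 := L3 pi x hpi0 hx ppi px opi
    rw [L2' _ _ hpi0 ppi opi hx px] at e1
    rw [L2' _ _ hx px ox hpi0 ppi, mul_comm] at e2
    rw [← sub_eq_zero]
    apply h2
    have e3 := congrArg₂ (· - ·) e1 e2
    simp only [sub_zero] at e3
    rw [← e3]; abel
  have opp : ∀ x, x ≠ 0 → 0 < ord x → ∃ y, y ≠ 0 ∧ ord y = ord x ∧ y / (1 - y) = x := by
    intro x hx px
    obtain ⟨o1, n1⟩ := hsub (-x) (neg_ne_zero.mpr hx) (by rw [ordneg x hx]; exact px)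
    rw [sub_neg_eq_add] at o1 n1
    refine ⟨x / (1 + x), div_ne_zero hx n1, by rw [orddiv _ _ hx n1, o1]; omega, ?_⟩
    have : 1 - x / (1 + x) = 1 / (1 + x) := by field_simp; ring
    rw [this]; field_simp
  have L5 : ∀ x, x ≠ 0 → 0 < ord x → Even (ord x) → B x = B pi + B pi - c := by
    intro x hx px ex
    have ppi : 0 < ord pi := by omega
    have opi : Odd (ord pi) := by rw [hpi]; exact odd_one
    have ox : ord (x / pi) = ord x - 1 := by rw [orddiv _ _ hx hpi0, hpi]
    have px' : 0 < ord (x / pi) := by rw [ox]; grind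
    obtain ⟨p, p0, po, pe⟩ := opp pi hpi0 ppi
    obtain ⟨q, q0, qo, qe⟩ := opp (x / pi) (div_ne_zero hx hpi0) px'
    have oq : Odd (ord q) := by rw [qo, ox]; grind
    have op : Odd (ord p) := by rw [po]; exact opi
    have e1 := L3 p q p0 q0 (by omega) (by omega) op
    rw [pe, qe, mul_div_cancel₀ _ hpi0, L2' _ _ q0 (by omega) oq p0 (by omega),
      L4 p p0 (by omega) op, L4 q q0 (by omega) oq] at e1
    rw [eq_comm, ← sub_eq_zero, ← e1]; abel
  have ppi : 0 < ord pi := by omega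
  have opi : Odd (ord pi) := by rw [hpi]; exact odd_one
  have L6 : B pi = c := by
    have hx := pow_ne_zero 2 hpi0
    have ox : ord (pi ^ 2) = 2 := by rw [pow_two, hmul _ _ hpi0 hpi0, hpi]; rfl
    obtain ⟨o1, n1⟩ := hsub pi hpi0 ppi
    obtain ⟨o2, n2⟩ := hsub _ hx (by omega)
    have d1 := div_ne_zero hpi0 n1
    have d2 := div_ne_zero hx n2
    have d3 := div_ne_zero hx n1
    have d4 := mul_ne_zero d1 d2
    have od1 : ord (pi / (1 - pi)) = 1 := by rw [orddiv _ _ hpi0 n1]; omega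
    have od2 : ord (pi ^ 2 / (1 - pi ^ 2)) = 2 := by rw [orddiv _ _ hx n2]; omega
    have od3 : ord (pi ^ 2 / (1 - pi)) = 2 := by rw [orddiv _ _ hx n1]; omega
    have od4 : ord (pi / (1 - pi) * (pi ^ 2 / (1 - pi ^ 2))) = 3 := by
      rw [hmul _ _ d1 d2]; omega
    have e1 := L3 pi (pi ^ 2) hpi0 hx ppi (by omega) opi
    rw [L4 _ d4 (by omega) (by rw [od4]; decide), L5 _ hx (by omega) (by rw [ox]; decide),
      L5 _ d3 (by omega) (by rw [od3]; decide)] at e1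
    rw [← sub_eq_zero, ← e1]; abel
  have L7 : ∀ x, x ≠ 0 → 0 < ord x → B x = c := by
    intro x hx px
    rcases Int.even_or_odd (ord x) with h | h
    · rw [L5 x hx px h, L6]; abel
    · rw [L4 x hx px h, L6]
  refine ⟨c, hc, L7, ?_, ?_⟩
  · intro x hx px
    have := hc x hx (posne1 x px)
    rw [L7 x hx px] at this
    simpa using this
  · have i0 := inv_ne_zero hpi0
    obtain ⟨o1, n1⟩ := hsub pi hpi0 ppi
    have e := five pi pi⁻¹ hpi0 (posne1 pi ppi) i0 (by
      intro h; exact posne1 pi ppi (inv_eq_one.mp h))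
    have m0 : -pi ≠ 0 := neg_ne_zero.mpr hpi0
    have n1' : pi - 1 ≠ 0 := by intro h; apply n1; linear_combination -h
    have a1 : (1 - pi⁻¹) / (1 - pi⁻¹⁻¹) = (-pi)⁻¹ := by
      rw [inv_inv]; field_simp; ring
    have a2 : (1 - pi) / (1 - pi⁻¹) = -pi := by
      have p : 1 - pi⁻¹ = (pi - 1) / pi := by field_simp
      rw [p]; field_simp; ring
    have a3 : pi⁻¹ / pi = (pi * pi)⁻¹ := by field_simp
    rw [a1, a2, a3, (posfacts pi hpi0 ppi).1, (posfacts pi hpi0 ppi).2, hso _ hpi0 opi,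
      hinv _ m0, hinv _ hpi0, hinv _ (mul_ne_zero hpi0 hpi0), L6,
      L7 (-pi) m0 (by rw [ordneg _ hpi0]; exact ppi),
      L7 (pi * pi) (mul_ne_zero hpi0 hpi0) (by rw [hmul _ _ hpi0 hpi0]; omega)] at e
    simp only [smul_neg, neg_smul, one_smul, neg_neg] at e
    rw [← e, show (3 : ℤ) = 1 + 1 + 1 by norm_num, add_smul, add_smul, one_smul]; abel
theorem kv_pbk_aux (A B : Type) (iA : AddCommGroup A) (iB : AddCommGroup B) (h : A = B)
    (hi : HEq iA iB) {ι : Type} (f : ι → A) (g : ι → B) (hfg : HEq f g) :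
    ∃ e : A ≃+ B, ∀ i, e (f i) = g i := by
  subst h
  obtain rfl := eq_of_heq hi
  obtain rfl := eq_of_heq hfg
  exact ⟨AddEquiv.refl _, fun _ => rfl⟩

theorem kv_mpr_heq.{u} {α β : Sort u} (h : α = β) (b : β) : HEq (h.mpr b) b := by
  subst h; rfl

theorem kv_rec_true.{u} {p : Prop} {m : Decidable p → Sort u} (f : ∀ h, m (isFalse h))
    (g : ∀ h, m (isTrue h)) (d : Decidable p) (h : p) :
    HEq (@Decidable.rec p m f g d) (g h) := by
  cases d with
  | isFalse h' => exact absurd h h'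
  | isTrue h' => rfl

theorem kv_rec_false.{u} {p : Prop} {m : Decidable p → Sort u} (f : ∀ h, m (isFalse h))
    (g : ∀ h, m (isTrue h)) (d : Decidable p) (h : ¬ p) :
    HEq (@Decidable.rec p m f g d) (f h) := by
  cases d with
  | isFalse h' => rfl
  | isTrue h' => exact absurd h' h

theorem kv_pbk2 (k : Type) [Field k] (h : Nat.card k = 2) :
    ∃ e : PBK k ≃+ ZMod 3, ∀ u, e (pbK' k u) = 0 := by
  refine kv_pbk_aux (PBK k) (ZMod 3) _ _ (if_pos h) ?_ (pbK' k) (fun _ => 0) ?_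
  · unfold instAddCommGroupPBK
    simp only [id]
    exact (kv_rec_true _ _ _ h).trans (kv_mpr_heq _ _)
  · unfold pbK'
    simp only [id]
    rw [dif_pos h]
    exact kv_mpr_heq _ _

theorem kv_pbk3 (k : Type) [Field k] (h : Nat.card k = 3) :
    ∃ e : PBK k ≃+ ZMod 4, ∀ u, e (pbK' k u) = if (u : k) = 1 then 0 else 1 := by
  have h2 : Nat.card k ≠ 2 := by omega
  refine kv_pbk_aux (PBK k) (ZMod 4) _ _ ((if_neg h2).trans (if_pos h)) ?_ (pbK' k) (fun u => if (u : k) = 1 then 0 else 1) ?_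
  · unfold instAddCommGroupPBK
    simp only [id]
    refine (kv_rec_false _ _ _ h2).trans ((kv_mpr_heq _ _).trans ?_)
    exact (kv_rec_true _ _ _ h).trans (kv_mpr_heq _ _)
  · unfold pbK'
    simp only [id]
    rw [dif_neg h2, dif_pos h]
    exact (kv_mpr_heq _ _).trans (kv_mpr_heq _ _)

theorem kv_pbk4 (k : Type) [Field k] (h2 : Nat.card k ≠ 2) (h : Nat.card k ≠ 3) :
    ∃ e : PBK k ≃+ PBloch k, ∀ u, e (pbK' k u) = pb k u := by
  refine kv_pbk_aux (PBK k) (PBloch k) _ _ ((if_neg h2).trans (if_neg h)) ?_ (pbK' k) (pb k) ?_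
  · unfold instAddCommGroupPBK
    simp only [id]
    refine (kv_rec_false _ _ _ h2).trans ((kv_mpr_heq _ _).trans ?_)
    exact (kv_rec_false _ _ _ h).trans (kv_mpr_heq _ _)
  · unfold pbK'
    simp only [id]
    rw [dif_neg h2, dif_neg h]
    exact (kv_mpr_heq _ _).trans (kv_mpr_heq _ _)

theorem kv_rpk_aux {R : Type} [Ring R] (A : ModuleCat.{0} R) (B : ModuleCat.{0} R) (h : A = B)
    {ι : Type} (f : ι → A) (g : ι → B) (hfg : HEq f g) :
    ∃ e : A ≃ₗ[R] B, ∀ i, e (f i) = g i := by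
  subst h
  obtain rfl := eq_of_heq hfg
  exact ⟨LinearEquiv.refl _ _, fun _ => rfl⟩

theorem kv_rpk2 (k : Type) [Field k] (h : Nat.card k = 2) :
    letI := trivMod k (ZMod 3)
    ∃ e : RP'K k ≃ₗ[RF k] ZMod 3, ∀ u, e (rpK k u) = 0 := by
  letI := trivMod k (ZMod 3)
  refine kv_rpk_aux (RP'Kb k) (ModuleCat.of (RF k) (ZMod 3)) (if_pos h) (rpK k) (fun _ => (0 : ZMod 3)) ?_
  unfold rpK
  simp only [id]
  rw [dif_pos h]
  exact kv_mpr_heq _ _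

theorem kv_rpk3 (k : Type) [Field k] (h : Nat.card k = 3) :
    ∃ e : RP'K k ≃ₗ[RF k] RP'3 k, ∀ u, e (rpK k u) = 
      if (u : k) = 1 then 0 else Submodule.Quotient.mk (1 : RF k) := by
  have h2 : Nat.card k ≠ 2 := by omega
  refine kv_rpk_aux (RP'Kb k) (ModuleCat.of (RF k) (RP'3 k)) ((if_neg h2).trans (if_pos h)) (rpK k)
    (fun u => if (u : k) = 1 then 0 else (Submodule.Quotient.mk (1 : RF k) : RP'3 k)) ?_
  unfold rpK
  simp only [id]
  rw [dif_neg h2, dif_pos h]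
  exact (kv_mpr_heq _ _).trans (kv_mpr_heq _ _)

theorem kv_rpk4 (k : Type) [Field k] (h2 : Nat.card k ≠ 2) (h : Nat.card k ≠ 3) :
    ∃ e : RP'K k ≃ₗ[RF k] RP' k, ∀ u, e (rpK k u) = rp k u := by
  refine kv_rpk_aux (RP'Kb k) (ModuleCat.of (RF k) (RP' k)) ((if_neg h2).trans (if_neg h)) (rpK k)
    (rp k) ?_
  unfold rpK
  simp only [id]
  rw [dif_neg h2, dif_neg h]
  exact (kv_mpr_heq _ _).trans (kv_mpr_heq _ _)

theorem kv_loc_surj {R : Type} [CommRing R] (P : Type) [AddCommGroup P] [Module R P]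
    (q : LocalizedModule (Submonoid.powers (2 : R)) P) :
    ∃ (n : ℕ) (p : P), (2 ^ n : ℕ) • q =
      LocalizedModule.mkLinearMap (Submonoid.powers (2 : R)) P p := by
  induction q using LocalizedModule.induction_on with
  | h m s =>
    obtain ⟨_, n, rfl⟩ := s
    refine ⟨n, m, ?_⟩
    have h1 := LocalizedModule.mk_cancel (S := Submonoid.powers (2 : R))
      (⟨2 ^ n, n, rfl⟩ : Submonoid.powers (2 : R)) m
    have h2 : (2 ^ n : R) • LocalizedModule.mk m (⟨2 ^ n, n, rfl⟩ : Submonoid.powers (2 : R))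
       = LocalizedModule.mk ((2 ^ n : R) • m) (⟨2 ^ n, n, rfl⟩ : Submonoid.powers (2 : R)) :=
      LocalizedModule.smul'_mk _ _ _
    rw [← Nat.cast_smul_eq_nsmul R]
    push_cast
    exact h2.trans h1

theorem kv_loc_bij {R : Type} [CommRing R] (P : Type) [AddCommGroup P] [Module R P] :
    Function.Bijective (fun q : LocalizedModule (Submonoid.powers (2 : R)) P => q + q) := by
  have h := IsLocalizedModule.map_units (LocalizedModule.mkLinearMap (Submonoid.powers (2 : R)) P)
    ⟨2, Submonoid.mem_powers 2⟩
  rw [Module.End.isUnit_iff] at h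
  convert h using 1
  funext q
  simp only [Module.algebraMap_end_apply]
  rw [ofNat_smul_eq_nsmul, two_nsmul]

theorem kv_locZ_surj (P : Type) [AddCommGroup P]
    (q : LocalizedModule (Submonoid.powers (2 : ℤ)) P) :
    ∃ (n : ℕ) (p : P), (2 ^ n : ℕ) • q = toLocZ P p := kv_loc_surj P q

theorem kv_locZ_bij (P : Type) [AddCommGroup P] :
    Function.Bijective (fun q : LocalizedModule (Submonoid.powers (2 : ℤ)) P => q + q) :=
  kv_loc_bij P

theorem kv_pow2_inj {X : Type} [AddCommGroup X] (h2 : ∀ z : X, z + z = 0 → z = 0)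
    (n : ℕ) (z : X) (h : (2 ^ n : ℕ) • z = 0) : z = 0 := by
  induction n with
  | zero => simpa using h
  | succ n ih =>
    apply ih
    apply h2
    rw [← two_nsmul, ← mul_nsmul, ← pow_succ, h]

theorem kv_locZ_ext {P X : Type} [AddCommGroup P] [AddCommGroup X]
    (h2 : ∀ z : X, z + z = 0 → z = 0)
    (f g : LocalizedModule (Submonoid.powers (2 : ℤ)) P →+ X)
    (h : ∀ p, f (toLocZ P p) = g (toLocZ P p)) (q) : f q = g q := by
  obtain ⟨n, p, hp⟩ := kv_locZ_surj P q
  rw [← sub_eq_zero]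
  apply kv_pow2_inj h2 n
  rw [smul_sub, ← map_nsmul, ← map_nsmul, hp, h, sub_self]

noncomputable def toLocZHom (P : Type) [AddCommGroup P] : P →+ LocalizedModule (Submonoid.powers (2 : ℤ)) P :=
  (LocalizedModule.mkLinearMap (Submonoid.powers (2 : ℤ)) P).toAddMonoidHom

theorem toLocZHom_apply (P : Type) [AddCommGroup P] (p : P) : toLocZHom P p = toLocZ P p := rfl

theorem kv_unit_pow {R X : Type} [CommRing R] [AddCommGroup X] [Module R X]
    (h2 : Function.Bijective (fun z : X => z + z)) (x : Submonoid.powers (2 : R)) :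
    IsUnit ((algebraMap R (Module.End R X)) x) := by
  obtain ⟨_, n, rfl⟩ := x
  simp only [map_pow]
  apply IsUnit.pow
  rw [Module.End.isUnit_iff]
  convert h2 using 1
  funext q
  simp only [Module.algebraMap_end_apply]
  rw [ofNat_smul_eq_nsmul, two_nsmul]

theorem kv_loc_lift {R : Type} [CommRing R] {P X : Type} [AddCommGroup P] [AddCommGroup X]
    [Module R P] [Module R X]
    (h2 : Function.Bijective (fun z : X => z + z)) (f : P →ₗ[R] X) :
    ∃ s : LocalizedModule (Submonoid.powers (2 : R)) P →ₗ[R] X,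
      ∀ p, s (LocalizedModule.mkLinearMap (Submonoid.powers (2 : R)) P p) = f p := by
  refine ⟨(LocalizedModule.lift (Submonoid.powers (2 : R)) f
    (fun x => kv_unit_pow h2 x)), fun p => ?_⟩
  exact LinearMap.congr_fun (LocalizedModule.lift_comp (Submonoid.powers (2 : R)) f
    (fun x => kv_unit_pow h2 x)) p

theorem kv_locZ_lift {P X : Type} [AddCommGroup P] [AddCommGroup X]
    (h2 : Function.Bijective (fun z : X => z + z)) (f : P →+ X) :
    ∃ s : LocalizedModule (Submonoid.powers (2 : ℤ)) P →+ X, ∀ p, s (toLocZ P p) = f p := by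
  obtain ⟨s, hs⟩ := kv_loc_lift h2 f.toIntLinearMap
  exact ⟨s.toAddMonoidHom, hs⟩

theorem pb_one (k : Type) [Field k] : pb k 1 = 0 := by
  refine (Submodule.Quotient.mk_eq_zero _).mpr (Submodule.subset_span (Or.inl rfl))

theorem pb_five (k : Type) [Field k] (x y : kˣ) (hx : (x : k) ≠ 1) (hy : (y : k) ≠ 1) :
    pb k x - pb k y + pb k (y * x⁻¹)
    - pb k (U k ((1 - (x : k)⁻¹) / (1 - (y : k)⁻¹))
        (div_ne_zero (one_sub_inv_ne hx) (one_sub_inv_ne hy)))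
    + pb k (U k ((1 - (x : k)) / (1 - (y : k)))
        (div_ne_zero (one_sub_ne hx) (one_sub_ne hy))) = 0 :=
  (Submodule.Quotient.mk_eq_zero _).mpr (Submodule.subset_span (Or.inr ⟨x, y, hx, hy, rfl⟩))

theorem pb_phi_mul (k : Type) [Field k] (a w : kˣ) (ha : a ≠ 1) (hw : w ≠ 1) (haw : a * w ≠ 1) :
    pb k (a * w) + pb k (a * w)⁻¹ = (pb k a + pb k a⁻¹) + (pb k w + pb k w⁻¹) := by
  have ha' : (a : k) ≠ 1 := by simpa using ha
  have hw' : (w : k) ≠ 1 := by simpa using hw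
  have haw' : (a : k) * w ≠ 1 := fun h => haw (Units.ext (by simpa using h))
  have n1 : (1 : k) - w ≠ 0 := sub_ne_zero.mpr (Ne.symm hw')
  have n2 : (1 : k) - a * w ≠ 0 := sub_ne_zero.mpr (Ne.symm haw')
  have n3 : (1 : k) - a ≠ 0 := sub_ne_zero.mpr (Ne.symm ha')
  obtain ⟨D, hD⟩ : ∃ D : k, D = 1 - a * w := ⟨_, rfl⟩
  rw [← hD] at n2
  obtain ⟨x, hxdef⟩ : ∃ x : kˣ, (x : k) = (1 - w) / D :=
    ⟨Units.mk0 _ (div_ne_zero n1 n2), rfl⟩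
  have hx1 : 1 - (x : k) = w * (1 - a) / D := by
    rw [hxdef]; field_simp; rw [hD]; ring
  have hy1 : 1 - ((a * x : kˣ) : k) = (1 - a) / D := by
    rw [Units.val_mul, hxdef]; field_simp; rw [hD]; ring
  have hx : (x : k) ≠ 1 := by
    intro h; rw [h, sub_self] at hx1
    exact div_ne_zero (mul_ne_zero w.ne_zero n3) n2 hx1.symm
  have hy : ((a * x : kˣ) : k) ≠ 1 := by
    intro h; rw [h, sub_self] at hy1
    exact div_ne_zero n3 n2 hy1.symm
  have e1 := pb_five k x (a * x) hx hy
  have e2 := pb_five k (a * x) x hy hx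
  have hW : (1 - (x : k)) / (1 - ((a * x : kˣ) : k)) = w := by
    rw [hx1, hy1]; field_simp
  have hZ : (1 - (x : k)⁻¹) / (1 - ((a * x : kˣ) : k)⁻¹) = a * w := by
    have p1 : 1 - (x : k)⁻¹ = - (1 - (x : k)) / x := by
      have := x.ne_zero; field_simp; ring
    have p2 : 1 - ((a * x : kˣ) : k)⁻¹ = - (1 - ((a * x : kˣ) : k)) / ((a * x : kˣ) : k) := by
      have := (a * x).ne_zero; field_simp; ring
    rw [p1, p2, hx1, hy1, Units.val_mul]
    have := x.ne_zero
    have := a.ne_zero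
    field_simp
  have u1 : U k _ (div_ne_zero (one_sub_ne hx) (one_sub_ne hy)) = w := Units.ext hW
  have u2 : U k _ (div_ne_zero (one_sub_ne hy) (one_sub_ne hx)) = w⁻¹ := by
    apply Units.ext
    show _ / _ = _
    rw [Units.val_inv_eq_inv_val, ← hW, inv_div]
  have u3 : U k _ (div_ne_zero (one_sub_inv_ne hx) (one_sub_inv_ne hy)) = a * w := Units.ext hZ
  have u4 : U k _ (div_ne_zero (one_sub_inv_ne hy) (one_sub_inv_ne hx)) = (a * w)⁻¹ := by
    apply Units.ext
    show _ / _ = _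
    rw [Units.val_inv_eq_inv_val, Units.val_mul a w, ← hZ, inv_div]
  have u5 : a * x * x⁻¹ = a := by group
  have u6 : x * (a * x)⁻¹ = a⁻¹ := by rw [mul_inv_rev]; group
  rw [u1, u3, u5] at e1
  rw [u2, u4, u6] at e2
  have e3 := congrArg₂ (· + ·) e1 e2
  simp only [add_zero] at e3
  rw [eq_comm, ← sub_eq_zero, ← e3]; abel

theorem kv_third (k : Type) [Field k] (h2 : Nat.card k ≠ 2) (h3 : Nat.card k ≠ 3) (b : kˣ) :
    ∃ c : kˣ, c ≠ 1 ∧ c ≠ b := by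
  by_contra! h
  have hs : (Set.univ : Set k) ⊆ (({0, 1, (b : k)} : Finset k) : Set k) := by
    intro x _
    by_cases hx : x = 0
    · simp [hx]
    · by_cases hx1 : x = 1
      · simp [hx1]
      · have := h (Units.mk0 x hx) (by intro h'; apply hx1; simpa using congrArg Units.val h')
        have := congrArg Units.val this
        simp only [Units.val_mk0] at this
        simp [this]
  have hf : Finite k := Set.finite_univ_iff.mp ((Finset.finite_toSet _).subset hs)
  have h1 := Set.ncard_le_ncard hs (Finset.finite_toSet _)
  rw [Set.ncard_univ, Set.ncard_coe_finset] at h1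
  have h4 : ({0, 1, (b : k)} : Finset k).card ≤ 3 := Finset.card_le_three
  have h5 : 1 < Nat.card k := Finite.one_lt_card
  omega

theorem pb_phi_two (k : Type) [Field k] (h2 : Nat.card k ≠ 2) (h3 : Nat.card k ≠ 3) (b : kˣ) :
    (pb k b + pb k b⁻¹) + (pb k b + pb k b⁻¹) = 0 := by
  by_cases hb : b = 1
  · subst hb; simp [pb_one]
  obtain ⟨c, hc1, hcb⟩ := kv_third k h2 h3 b⁻¹
  have hbc : b * c ≠ 1 := by
    intro h; exact hcb (eq_inv_of_mul_eq_one_right h)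
  have e1 := pb_phi_mul k b c hb hc1 hbc
  have hh : b * c * b⁻¹ = c := by rw [mul_comm b c]; group
  have e2 := pb_phi_mul k (b * c) b⁻¹ hbc (by simpa using hb) (by rw [hh]; exact hc1)
  rw [hh, e1, inv_inv] at e2
  have e3 := sub_eq_zero.mpr e2.symm
  rw [← e3]; abel

/-- what is needed about the residue field -/
def KvData (k : Type) [Field k] (crk : RP'K k) : Prop :=
  ∃ θ : RP'K k →+ LocalizedModule (Submonoid.powers (2 : ℤ)) (PBK k),
    (∀ a m, θ (cls k a • m) = θ m) ∧
    (∀ u, θ (rpK k u) = toLocZ _ (pbK' k u)) ∧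
    Submodule.span (RF k) (Set.range (rpK k) ∪ {crk}) = ⊤ ∧
    (∀ (X : Type) [AddCommGroup X], Function.Bijective (fun z : X => z + z) →
      ∀ (e : kˣ → X) (c : X), e 1 = 0 → (∀ u, e u⁻¹ = - e u) →
      (∀ (u : kˣ) (hu : (u : k) ≠ 1), e u + e (U k (1 - (u : k)) (one_sub_ne hu)) = c) →
      (3 : ℤ) • c = 0 →
      (∀ (x y : kˣ) (hx : (x : k) ≠ 1) (hy : (y : k) ≠ 1),
        e x - e y + e (y * x⁻¹)
        - e (U k ((1 - (x : k)⁻¹) / (1 - (y : k)⁻¹))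
            (div_ne_zero (one_sub_inv_ne hx) (one_sub_inv_ne hy)))
        + e (U k ((1 - (x : k)) / (1 - (y : k)))
            (div_ne_zero (one_sub_ne hx) (one_sub_ne hy))) = 0) →
      ∃ s : LocalizedModule (Submonoid.powers (2 : ℤ)) (PBK k) →+ X,
        (∀ u, s (toLocZ _ (pbK' k u)) = e u) ∧ s (θ crk) = c) ∧
    (∀ f : LocalizedModule (Submonoid.powers (2 : ℤ)) (PBK k) →+
        LocalizedModule (Submonoid.powers (2 : ℤ)) (PBK k),
      (∀ u, f (toLocZ _ (pbK' k u)) = toLocZ _ (pbK' k u)) → f (θ crk) = θ crk →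
      ∀ q, f q = q)

theorem kv_inj_of_bij {X : Type} [AddCommGroup X]
    (h : Function.Bijective (fun z : X => z + z)) (z : X) (hz : z + z = 0) : z = 0 :=
  h.1 (by simpa using hz)

theorem augRF_cls (k : Type) [Field k] (a : kˣ) : augRF k (cls k a) = 1 := by
  unfold augRF cls
  simp

theorem kv_data2 (k : Type) [Field k] (h : Nat.card k = 2) (crk : RP'K k) (hc : crk ≠ 0) :
    KvData k crk := by
  obtain ⟨eP, hP⟩ := kv_pbk2 k h
  letI := trivMod k (ZMod 3)
  obtain ⟨eA, hA⟩ := kv_rpk2 k h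
  have hP' : ∀ u, pbK' k u = 0 := fun u => eP.injective (by rw [hP, map_zero])
  have hA' : ∀ u, rpK k u = 0 := fun u => eA.injective (by rw [hA, map_zero])
  have hc' : eA crk ≠ 0 := by simpa using hc
  have hc3 : eA crk = 1 ∨ eA crk = -1 := by
    have : ∀ z : ZMod 3, z ≠ 0 → z = 1 ∨ z = -1 := by decide
    exact this _ hc'
  have hun : ∀ u : kˣ, u = 1 := by
    intro u
    have hf : Finite k := Nat.finite_of_card_ne_zero (by omega)
    have : Nat.card kˣ = 1 := by rw [Nat.card_units, h]
    exact (Nat.card_eq_one_iff_unique.mp this).1.elim _ _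
  refine ⟨(toLocZHom _).comp (eP.symm.toAddMonoidHom.comp eA.toAddEquiv.toAddMonoidHom),
    ?_, ?_, ?_, ?_, ?_⟩
  · intro a m
    show toLocZHom _ (eP.symm (eA (cls k a • m))) = toLocZHom _ (eP.symm (eA m))
    rw [map_smul]
    congr 2
    show augRF k (cls k a) • eA m = eA m
    rw [augRF_cls, one_smul]
  · intro u
    rw [hA', hP', map_zero]
    exact (map_zero (toLocZHom _)).symm
  · rw [eq_top_iff]
    intro m _
    have hm : crk ∈ Submodule.span (RF k) (Set.range (rpK k) ∪ {crk}) :=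
      Submodule.subset_span (Or.inr rfl)
    have h3 : ∀ y z : ZMod 3, y ≠ 0 → z = 0 ∨ z = y ∨ z = -y := by decide
    rcases h3 _ (eA m) hc' with h | h | h
    · rw [eA.injective (h.trans (map_zero eA).symm)]; exact Submodule.zero_mem _
    · rw [eA.injective h]; exact hm
    · rw [eA.injective (h.trans (map_neg eA crk).symm)]; exact Submodule.neg_mem _ hm
  · intro X _ h2 e c e1 _ _ c3 _
    have key : ∀ d : X, (3 : ℤ) • d = 0 → ∃ f : ZMod 3 →+ X, f 1 = d := by
      intro d hd
      refine ⟨ZMod.lift 3 ⟨zmultiplesHom X d, by simpa using hd⟩, ?_⟩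
      have := ZMod.lift_coe 3 ⟨zmultiplesHom X d, by simpa using hd⟩ 1
      simpa using this
    obtain ⟨f, hf⟩ : ∃ f : ZMod 3 →+ X, f (eA crk) = c := by
      rcases hc3 with h | h
      · obtain ⟨f, hf⟩ := key c c3
        exact ⟨f, by rw [h, hf]⟩
      · obtain ⟨f, hf⟩ := key (-c) (by rw [smul_neg, c3, neg_zero])
        exact ⟨f, by rw [h, map_neg, hf, neg_neg]⟩
    obtain ⟨s, hs⟩ := kv_locZ_lift h2 (f.comp eP.toAddMonoidHom)
    refine ⟨s, ?_, ?_⟩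
    · intro u
      rw [hs, hP', map_zero, hun u, e1]
    · show s (toLocZ _ (eP.symm (eA crk))) = c
      rw [hs]
      show f (eP (eP.symm (eA crk))) = c
      rw [AddEquiv.apply_symm_apply, hf]
  · intro f _ hf q
    refine kv_locZ_ext (kv_inj_of_bij (kv_locZ_bij _)) f (AddMonoidHom.id _) ?_ q
    intro p
    change f (toLocZHom _ (eP.symm (eA crk))) = toLocZHom _ (eP.symm (eA crk)) at hf
    change f (toLocZHom _ p) = toLocZHom _ p
    have h3 : ∀ y z : ZMod 3, y ≠ 0 → z = 0 ∨ z = y ∨ z = -y := by decide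
    obtain ⟨p, rfl⟩ := eP.symm.surjective p
    rcases h3 _ p hc' with h | h | h
    · rw [h]; simp
    · rw [h, hf]
    · rw [h]; simp only [map_neg]; rw [hf]

theorem kv_data3 (k : Type) [Field k] (h : Nat.card k = 3) (crk : RP'K k) :
    KvData k crk := by
  obtain ⟨eP, hP⟩ := kv_pbk3 k h
  obtain ⟨eA, hA⟩ := kv_rpk3 k h
  have h4 : ∀ p : PBK k, p + p + (p + p) = 0 := by
    intro p
    apply eP.injective
    simp only [map_add, map_zero]
    generalize eP p = z
    revert z; decide
  have hQ : ∀ q : LocalizedModule (Submonoid.powers (2 : ℤ)) (PBK k), q = 0 := by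
    refine kv_locZ_ext (kv_inj_of_bij (kv_locZ_bij _)) (AddMonoidHom.id _) 0 ?_
    intro p
    show toLocZHom _ p = 0
    apply kv_inj_of_bij (kv_locZ_bij _)
    apply kv_inj_of_bij (kv_locZ_bij _)
    rw [← map_add, ← map_add, h4, map_zero]
  have hf : Finite k := Nat.finite_of_card_ne_zero (by omega)
  have hm1 : (-1 : kˣ) ≠ 1 := by
    intro h1
    have h2 : (-1 : k) = 1 := by simpa using congrArg Units.val h1
    have h5 : (2 : k) = 0 := by linear_combination -h2
    have h6 : (3 : k) = 0 := by
      have := card_nsmul_eq_zero' (x := (1 : k))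
      rw [h] at this; simpa using this
    have h7 : (1 : k) = 0 := by linear_combination h6 - h5
    exact one_ne_zero h7
  have hun : ∀ u : kˣ, u = 1 ∨ u = -1 := by
    intro u
    have hc : Nat.card kˣ = 2 := by rw [Nat.card_units, h]
    have hu2 := Nat.card_eq_two_iff.mp hc
    obtain ⟨x, y, hxy, hs⟩ := hu2
    have a := (Set.ext_iff.mp hs 1).mpr trivial
    have b := (Set.ext_iff.mp hs (-1)).mpr trivial
    have c := (Set.ext_iff.mp hs u).mpr trivial
    simp only [Set.mem_insert_iff, Set.mem_singleton_iff] at a b c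
    grind
  refine ⟨0, fun _ _ => rfl, fun u => ((hQ _).trans (hQ _).symm), ?_, ?_, fun f _ _ q => (hQ _).trans (hQ _).symm⟩
  · rw [eq_top_iff]
    intro m _
    have hm : rpK k (-1) ∈ Submodule.span (RF k) (Set.range (rpK k) ∪ {crk}) :=
      Submodule.subset_span (Or.inl ⟨_, rfl⟩)
    have h1 : eA (rpK k (-1)) = Submodule.Quotient.mk (1 : RF k) := by
      rw [hA, if_neg]
      intro h; exact hm1 (Units.ext h)
    obtain ⟨r, hr⟩ := Submodule.Quotient.mk_surjective _ (eA m)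
    have : m = r • rpK k (-1) := by
      apply eA.injective
      rw [map_smul, h1, ← hr]
      refine Eq.trans ?_ (Submodule.Quotient.mk_smul _ _ _)
      rw [smul_eq_mul, mul_one]
    rw [this]
    exact Submodule.smul_mem _ _ hm
  · intro X _ h2 e c e1 ei ec _ _
    have hem : e (-1) = 0 := by
      apply kv_inj_of_bij h2
      have := ei (-1)
      rw [inv_neg, inv_one] at this
      nth_rewrite 1 [this]
      exact neg_add_cancel _
    have he : ∀ u, e u = 0 := by
      intro u
      rcases hun u with rfl | rfl
      · exact e1
      · exact hem
    refine ⟨0, fun u => by rw [he]; rfl, ?_⟩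
    rw [← ec (-1) (fun h => hm1 (Units.ext h)), he, he]
    simp

theorem kv_rp_span (k : Type) [Field k] : Submodule.span (RF k) (Set.range (rp k)) = ⊤ := by
  rw [eq_top_iff]
  intro m _
  obtain ⟨f, rfl⟩ := Submodule.Quotient.mk_surjective _ m
  induction f using Finsupp.induction_linear with
  | zero => exact Submodule.zero_mem _
  | add f g hf hg => exact Submodule.add_mem _ (hf trivial) (hg trivial)
  | single a b =>
    have : (Submodule.Quotient.mk (Finsupp.single a b) : RP' k) = b • rp k a := by
      refine Eq.trans ?_ (Submodule.Quotient.mk_smul _ _ _)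
      congr 1
      simp [gen]
    refine (congrArg (· ∈ Submodule.span (RF k) (Set.range (rp k))) this).mpr ?_
    exact Submodule.smul_mem _ _ (Submodule.subset_span ⟨a, rfl⟩)

theorem kv_rp_lift (k : Type) [Field k] (X : Type) [AddCommGroup X] [Module (RF k) X]
    (e : kˣ → X) (e1 : e 1 = 0) (ei : ∀ u, e u⁻¹ + e u = 0)
    (em : ∀ u, cls k (-1) • e u - e u = 0)
    (e5 : ∀ (x y : kˣ) (hx : (x : k) ≠ 1) (hy : (y : k) ≠ 1),
        e x - e y + cls k x • e (y * x⁻¹)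
        - cls k (U k ((x : k)⁻¹ - 1) (inv_sub_one_ne hx)) • e (U k ((1 - (x : k)⁻¹) / (1 - (y : k)⁻¹))
            (div_ne_zero (one_sub_inv_ne hx) (one_sub_inv_ne hy)))
        + cls k (U k (1 - (x : k)) (one_sub_ne hx)) • e (U k ((1 - (x : k)) / (1 - (y : k)))
            (div_ne_zero (one_sub_ne hx) (one_sub_ne hy))) = 0) :
    ∃ s : RP' k →ₗ[RF k] X, ∀ u, s (rp k u) = e u := by
  have hg : ∀ u, Finsupp.linearCombination (RF k) e (gen k u) = e u := by
    intro u; simp [gen]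
  refine ⟨Submodule.liftQ _ (Finsupp.linearCombination (RF k) e) ?_, fun u => ?_⟩
  · rw [Submodule.span_le]
    rintro w (((hw | ⟨x, y, hx, hy, rfl⟩) | ⟨x, rfl⟩) | ⟨x, rfl⟩)
    · rw [Set.mem_singleton_iff] at hw
      subst hw
      show _ = _
      rw [hg, e1]
    · show _ = _
      rw [← e5 x y hx hy]
      simp only [FT, map_add, map_sub, map_smul, hg]
    · show _ = _
      rw [← em x]
      simp only [map_sub, map_smul, hg]
    · show _ = _
      rw [← ei x]
      simp only [map_add, hg]
  · exact (Submodule.liftQ_apply _ _ _).trans (hg u)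

theorem kv_pb_lift (k : Type) [Field k] (X : Type) [AddCommGroup X]
    (e : kˣ → X) (e1 : e 1 = 0)
    (e5 : ∀ (x y : kˣ) (hx : (x : k) ≠ 1) (hy : (y : k) ≠ 1),
        e x - e y + e (y * x⁻¹)
        - e (U k ((1 - (x : k)⁻¹) / (1 - (y : k)⁻¹))
            (div_ne_zero (one_sub_inv_ne hx) (one_sub_inv_ne hy)))
        + e (U k ((1 - (x : k)) / (1 - (y : k)))
            (div_ne_zero (one_sub_ne hx) (one_sub_ne hy))) = 0) :
    ∃ s : PBloch k →+ X, ∀ u, s (pb k u) = e u := by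
  have hg : ∀ u, Finsupp.linearCombination ℤ e (Finsupp.single u (1 : ℤ)) = e u := by
    intro u; simp
  let s0 := Submodule.liftQ (Submodule.span ℤ
    ({Finsupp.single (1 : kˣ) (1 : ℤ)} ∪
      {w | ∃ (x y : kˣ) (hx : (x : k) ≠ 1) (hy : (y : k) ≠ 1), w = FTZ k x y hx hy}))
      (Finsupp.linearCombination ℤ e) (by
    rw [Submodule.span_le]
    rintro w (hw | ⟨x, y, hx, hy, rfl⟩)
    · rw [Set.mem_singleton_iff] at hw
      subst hw
      show _ = _
      rw [hg, e1]
    · show _ = _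
      rw [← e5 x y hx hy]
      simp only [FTZ, map_add, map_sub, hg])
  refine ⟨s0.toAddMonoidHom, fun u => ?_⟩
  exact hg u

theorem kv_pb_ext (k : Type) [Field k] (X : Type) [AddCommGroup X]
    (f g : PBloch k →+ X) (h : ∀ u, f (pb k u) = g (pb k u)) (p : PBloch k) : f p = g p := by
  obtain ⟨p, rfl⟩ := Submodule.Quotient.mk_surjective _ p
  induction p using Finsupp.induction_linear with
  | zero => exact (map_zero f).trans (map_zero g).symm
  | add a b ha hb =>
    have h1 := map_add f (Submodule.Quotient.mk a : PBloch k) (Submodule.Quotient.mk b : PBloch k)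
    have h2 := map_add g (Submodule.Quotient.mk a : PBloch k) (Submodule.Quotient.mk b : PBloch k)
    exact h1.trans ((congrArg₂ (· + ·) ha hb).trans h2.symm)
  | single a b =>
    have : (Submodule.Quotient.mk (Finsupp.single a b) : PBloch k) = b • pb k a := by
      refine Eq.trans ?_ (Submodule.Quotient.mk_smul _ _ _)
      congr 1
      simp
    refine (congrArg f this).trans (Eq.trans ?_ (congrArg g this).symm)
    rw [map_zsmul, map_zsmul, h]

theorem kv_data4 (k : Type) [Field k] (h2 : Nat.card k ≠ 2) (h3 : Nat.card k ≠ 3) (crk : RP'K k)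
    (hcrk : ∀ (u : kˣ) (hu : (u : k) ≠ 1),
      crk = rpK _ u + rpK _ (U k (1 - (u : k)) (one_sub_ne hu))) :
    KvData k crk := by
  obtain ⟨eP, hP⟩ := kv_pbk4 k h2 h3
  obtain ⟨eA, hA⟩ := kv_rpk4 k h2 h3
  letI : Module (RF k) (LocalizedModule (Submonoid.powers (2 : ℤ)) (PBK k)) :=
    @Module.compHom _ _ _ _ _ (AddCommGroup.toIntModule _) _ (augRF k)
  have hsm : ∀ a (q : LocalizedModule (Submonoid.powers (2 : ℤ)) (PBK k)), cls k a • q = q := by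
    intro a q
    show (AddCommGroup.toIntModule _).toSMul.smul (augRF k (cls k a)) q = q
    rw [augRF_cls]
    exact one_zsmul q
  have hps : ∀ u, pbK' k u = eP.symm (pb k u) := fun u => by rw [← hP, AddEquiv.symm_apply_apply]
  obtain ⟨θ, hθ⟩ := kv_rp_lift k (LocalizedModule (Submonoid.powers (2 : ℤ)) (PBK k))
    (fun u => toLocZHom _ (eP.symm (pb k u))) (by simp [pb_one]) (by
      intro u
      apply kv_inj_of_bij (kv_locZ_bij _)
      simp only [← map_add]
      rw [add_comm (pb k u⁻¹), pb_phi_two k h2 h3, map_zero, map_zero])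
    (by intro u; rw [hsm, sub_self]) (by
      intro x y hx hy
      simp only [hsm]
      simp only [← map_add, ← map_sub]
      rw [pb_five k x y hx hy, map_zero, map_zero])
  have hθ' : ∀ u, θ (eA (rpK k u)) = toLocZ _ (pbK' k u) := by
    intro u
    rw [hA, hθ, hps]; rfl
  obtain ⟨u0, hu0, -⟩ := kv_third k h2 h3 1
  have hu0' : (u0 : k) ≠ 1 := fun h => hu0 (Units.ext h)
  refine ⟨θ.toAddMonoidHom.comp eA.toAddEquiv.toAddMonoidHom, ?_, hθ', ?_, ?_, ?_⟩
  · intro a m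
    show θ (eA (cls k a • m)) = θ (eA m)
    rw [map_smul, map_smul, hsm]
  · rw [eq_top_iff]
    intro m _
    have h1 : eA m ∈ Submodule.span (RF k) (Set.range (rp k)) := by
      rw [kv_rp_span]; trivial
    have h4 : Submodule.span (RF k) (Set.range (rp k)) ≤
        (Submodule.span (RF k) (Set.range (rpK k) ∪ {crk})).comap eA.symm.toLinearMap := by
      rw [Submodule.span_le]
      rintro _ ⟨u, rfl⟩
      show eA.symm (rp k u) ∈ Submodule.span (RF k) (Set.range (rpK k) ∪ {crk})
      rw [← hA, LinearEquiv.symm_apply_apply]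
      exact Submodule.subset_span (Or.inl ⟨u, rfl⟩)
    have h5 := h4 h1
    change eA.symm (eA m) ∈ Submodule.span (RF k) (Set.range (rpK k) ∪ {crk}) at h5
    rwa [LinearEquiv.symm_apply_apply] at h5
  · intro X _ hX e c e1 ei ec _ e5
    obtain ⟨f, hf⟩ := kv_pb_lift k X e e1 e5
    obtain ⟨s, hs⟩ := kv_locZ_lift hX (f.comp eP.toAddMonoidHom)
    have hsu : ∀ u, s (toLocZ _ (pbK' k u)) = e u := by
      intro u
      rw [hs]
      show f (eP (pbK' k u)) = e u
      rw [hP, hf]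
    refine ⟨s, hsu, ?_⟩
    show s (θ (eA crk)) = c
    rw [hcrk u0 hu0', map_add, map_add, hθ', hθ', map_add, hsu, hsu, ec u0 hu0']
  · intro f hf _ q
    refine kv_locZ_ext (kv_inj_of_bij (kv_locZ_bij _)) f (AddMonoidHom.id _) ?_ q
    intro p
    obtain ⟨p, rfl⟩ := eP.symm.surjective p
    refine kv_pb_ext k _ (f.comp ((toLocZHom _).comp eP.symm.toAddMonoidHom))
      ((toLocZHom _).comp eP.symm.toAddMonoidHom) ?_ p
    intro u
    have := hf u
    rw [hps] at this
    exact this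

theorem kv_data (k : Type) [Field k] (crk : RP'K k)
    (hcrk : ∀ (u : kˣ) (hu : (u : k) ≠ 1),
      crk = rpK _ u + rpK _ (U k (1 - (u : k)) (one_sub_ne hu)))
    (hcrk2 : Nat.card k = 2 → crk ≠ 0) : KvData k crk := by
  by_cases h2 : Nat.card k = 2
  · exact kv_data2 k h2 crk (hcrk2 h2)
  by_cases h3 : Nat.card k = 3
  · exact kv_data3 k h3 crk
  exact kv_data4 k h2 h3 crk hcrk

theorem kv_MA_ind {G : Type} [Monoid G] (P : MonoidAlgebra ℤ G → Prop) (h0 : P 0)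
    (hadd : ∀ a b, P a → P b → P (a + b)) (hneg : ∀ a, P a → P (-a))
    (hof : ∀ g, P (MonoidAlgebra.of ℤ G g)) (r : MonoidAlgebra ℤ G) : P r := by
  induction r using MonoidAlgebra.induction_on with
  | of g => exact hof g
  | add a b ha hb => exact hadd a b ha hb
  | smul n r hr =>
    induction n using Int.induction_on with
    | zero => rw [zero_smul]; exact h0
    | succ i ih => rw [add_smul, one_smul]; exact hadd _ _ ih hr
    | pred i ih => rw [sub_smul, one_smul, sub_eq_add_neg]; exact hadd _ _ ih (hneg _ hr)

theorem kv_RF_ind (F : Type) [Field F] (P : RF F → Prop) (h0 : P 0)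
    (hadd : ∀ a b, P a → P b → P (a + b)) (hneg : ∀ a, P a → P (-a))
    (hof : ∀ a, P (cls F a)) (r : RF F) : P r := by
  refine kv_MA_ind P h0 hadd hneg ?_ r
  intro g
  obtain ⟨a, rfl⟩ := QuotientGroup.mk_surjective g
  exact hof a

noncomputable def mkChiHom (F : Type) [Field F] (χ : SqCl F →* ℤˣ) (M : Type) [AddCommGroup M]
    [Module (RF F) M] : M →ₗ[RF F] ChiQuot F χ M := Submodule.mkQ (chiSub F χ M)

section
variable (F : Type) [Field F] (χ : SqCl F →* ℤˣ) (M : Type) [AddCommGroup M]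
    [Module (RF F) M]

theorem mkChiHom_apply (m : M) : mkChiHom F χ M m = mkChi F χ m := rfl

theorem mkChi_surj (z : ChiQuot F χ M) : ∃ m, mkChi F χ m = z :=
  Submodule.Quotient.mk_surjective _ z

theorem kv_chi_cls (a : Fˣ) (z : ChiQuot F χ M) :
    cls F a • z = ((χ (sqc F a) : ℤˣ) : ℤ) • z := by
  obtain ⟨m, rfl⟩ := mkChi_surj F χ M z
  rw [← mkChiHom_apply, ← map_smul, ← map_zsmul, ← sub_eq_zero, ← map_sub]
  exact (Submodule.Quotient.mk_eq_zero _).mpr (Submodule.subset_span ⟨a, m, rfl⟩)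

noncomputable def chiRF : RF F →+* ℤ :=
  ((MonoidAlgebra.lift ℤ ℤ (SqCl F)) ((Units.coeHom ℤ).comp χ)).toRingHom

theorem chiRF_cls (a : Fˣ) : chiRF F χ (cls F a) = ((χ (sqc F a) : ℤˣ) : ℤ) := by
  unfold chiRF cls
  simp

theorem kv_chi_smul (r : RF F) (z : ChiQuot F χ M) :
    r • z = (chiRF F χ r) • z := by
  refine kv_RF_ind F (fun r => r • z = (chiRF F χ r) • z) ?_ ?_ ?_ ?_ r
  · simp
  · intro a b ha hb
    rw [add_smul, map_add, add_smul, ha, hb]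
  · intro a ha
    rw [neg_smul, map_neg, neg_smul, ha]
  · intro a
    rw [kv_chi_cls, chiRF_cls]

theorem kv_chi_lift (X : Type) [AddCommGroup X] (f : M →+ X)
    (hf : ∀ a m, f (cls F a • m) = ((χ (sqc F a) : ℤˣ) : ℤ) • f m) :
    ∃ g : ChiQuot F χ M →+ X, ∀ m, g (mkChi F χ m) = f m := by
  have hr : ∀ (r : RF F) m, f (r • m) = chiRF F χ r • f m := by
    intro r m
    refine kv_RF_ind F (fun r => f (r • m) = (chiRF F χ r) • f m) ?_ ?_ ?_ ?_ r
    · simp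
    · intro a b ha hb
      rw [add_smul, map_add, map_add, add_smul, ha, hb]
    · intro a ha
      rw [neg_smul, map_neg, map_neg, neg_smul, ha]
    · intro a
      rw [hf, chiRF_cls]
  have hk : (chiSub F χ M).toAddSubgroup ≤ f.ker := by
    intro x hx
    have hx' : x ∈ chiSub F χ M := hx
    unfold chiSub at hx'
    clear hx
    rw [AddMonoidHom.mem_ker]
    induction hx' using Submodule.span_induction with
    | mem x h =>
      obtain ⟨a, m, rfl⟩ := h
      rw [map_sub, hf, map_zsmul, sub_self]
    | zero => exact map_zero f
    | add x y hx hy h1 h2 => rw [map_add, h1, h2, add_zero]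
    | smul r x hx h => rw [hr, h, smul_zero]
  exact ⟨QuotientAddGroup.lift _ f hk, fun m => rfl⟩

theorem kv_chi_bij (h : Function.Bijective (fun z : M => z + z)) :
    Function.Bijective (fun z : ChiQuot F χ M => z + z) := by
  let d : M ≃+ M := AddEquiv.ofBijective
    (AddMonoidHom.mk' (fun z : M => z + z) (fun a b => by abel)) h
  have hd : ∀ z, d z = z + z := fun z => rfl
  have hds : ∀ (r : RF F) z, d.symm (r • z) = r • d.symm z := by
    intro r z
    apply d.injective
    rw [AddEquiv.apply_symm_apply, hd, ← smul_add, ← hd, AddEquiv.apply_symm_apply]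
  obtain ⟨g, hg⟩ := kv_chi_lift F χ M (ChiQuot F χ M)
    ((mkChiHom F χ M).toAddMonoidHom.comp d.symm.toAddMonoidHom) (by
      intro a m
      show mkChiHom F χ M (d.symm (cls F a • m)) = _ • mkChiHom F χ M (d.symm m)
      rw [hds, map_smul, kv_chi_cls])
  have hg' : ∀ m, g (mkChi F χ m) = mkChiHom F χ M (d.symm m) := hg
  constructor
  · have : Function.LeftInverse g (fun z : ChiQuot F χ M => z + z) := by
      intro z
      obtain ⟨m, rfl⟩ := mkChi_surj F χ M z
      show g (mkChi F χ m + mkChi F χ m) = mkChi F χ m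
      rw [map_add, hg', ← map_add, ← map_add, ← hd, AddEquiv.symm_apply_apply]; rfl
    exact this.injective
  · intro z
    obtain ⟨m, rfl⟩ := mkChi_surj F χ M z
    refine ⟨mkChiHom F χ M (d.symm m), ?_⟩
    show mkChiHom F χ M (d.symm m) + mkChiHom F χ M (d.symm m) = mkChi F χ m
    rw [← map_add, ← hd, AddEquiv.apply_symm_apply]; rfl

end

theorem kv_loc2_bij (F : Type) [Field F] (M : Type) [AddCommGroup M] [Module (RF F) M] :
    Function.Bijective (fun z : Loc2 F M => z + z) := kv_loc_bij M

noncomputable def toLoc2Hom (F : Type) [Field F] (M : Type) [AddCommGroup M] [Module (RF F) M] :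
    M →ₗ[RF F] Loc2 F M := LocalizedModule.mkLinearMap (Submonoid.powers (2 : RF F)) M

theorem toLoc2Hom_apply (F : Type) [Field F] (M : Type) [AddCommGroup M] [Module (RF F) M] (m : M) :
    toLoc2Hom F M m = toLoc2 F m := rfl

theorem kv_loc2_surj (F : Type) [Field F] (M : Type) [AddCommGroup M] [Module (RF F) M]
    (q : Loc2 F M) : ∃ (n : ℕ) (p : M), (2 ^ n : ℕ) • q = toLoc2 F p := kv_loc_surj M q

theorem kv_loc2_ext (F : Type) [Field F] (M X : Type) [AddCommGroup M] [Module (RF F) M]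
    [AddCommGroup X] (h2 : ∀ z : X, z + z = 0 → z = 0) (f g : Loc2 F M →+ X)
    (h : ∀ m, f (toLoc2 F m) = g (toLoc2 F m)) (q) : f q = g q := by
  obtain ⟨n, p, hp⟩ := kv_loc2_surj F M q
  rw [← sub_eq_zero]
  apply kv_pow2_inj h2 n
  rw [smul_sub, ← map_nsmul, ← map_nsmul, hp, h, sub_self]

/-- homs out of the F-side are determined on generators -/
theorem kv_F_ext (F : Type) [Field F] (χ : SqCl F →* ℤˣ) (X : Type) [AddCommGroup X]
    (h2 : ∀ z : X, z + z = 0 → z = 0) (f g : ChiQuot F χ (Loc2 F (RP' F)) →+ X)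
    (h : ∀ x, f (mkChi F χ (toLoc2 F (rp F x))) = g (mkChi F χ (toLoc2 F (rp F x)))) (z) :
    f z = g z := by
  obtain ⟨m, rfl⟩ := mkChi_surj F χ _ z
  refine kv_loc2_ext F _ X h2 (f.comp (mkChiHom F χ _).toAddMonoidHom)
    (g.comp (mkChiHom F χ _).toAddMonoidHom) ?_ m
  intro p
  show f (mkChiHom F χ _ (toLoc2Hom F _ p)) = g (mkChiHom F χ _ (toLoc2Hom F _ p))
  have hp : p ∈ Submodule.span (RF F) (Set.range (rp F)) := by rw [kv_rp_span]; trivial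
  induction hp using Submodule.span_induction with
  | mem x hx => obtain ⟨x, rfl⟩ := hx; exact h x
  | zero => simp only [map_zero]
  | add x y _ _ hx hy => simp only [map_add, hx, hy]
  | smul r x _ hx => simp only [map_smul, kv_chi_smul, map_zsmul, hx]

section
variable (F : Type) [Field F] (v : Valuation F (WithZero (Multiplicative ℤ)))
  (M : Type) [AddCommGroup M] [Module (RF (Resk F v)) M]

theorem indE_add_left (r s : RF F) (m : M) :
    indE F v M (r + s) m = indE F v M r m + indE F v M s m := by
  letI : Module (ZU F v) (RF F) := Module.compHom _ (zuF F v)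
  letI : Module (ZU F v) M := Module.compHom _ (zuK F v)
  exact TensorProduct.add_tmul r s m

theorem indE_add_right (r : RF F) (m n : M) :
    indE F v M r (m + n) = indE F v M r m + indE F v M r n := by
  letI : Module (ZU F v) (RF F) := Module.compHom _ (zuF F v)
  letI : Module (ZU F v) M := Module.compHom _ (zuK F v)
  exact TensorProduct.tmul_add r m n

theorem smul_indE (r s : RF F) (m : M) :
    r • indE F v M s m = indE F v M (r * s) m := by
  letI : Module (ZU F v) (RF F) := Module.compHom _ (zuF F v)
  letI : Module (ZU F v) M := Module.compHom _ (zuK F v)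
  letI : SMulCommClass (ZU F v) (RF F) (RF F) :=
    ⟨fun r s t => by
      show zuF F v r * (s * t) = s * (zuF F v r * t)
      ring⟩
  exact TensorProduct.smul_tmul' r s m

theorem indE_bal (z : ZU F v) (s : RF F) (m : M) :
    indE F v M (zuF F v z * s) m = indE F v M s (zuK F v z • m) := by
  letI : Module (ZU F v) (RF F) := Module.compHom _ (zuF F v)
  letI : Module (ZU F v) M := Module.compHom _ (zuK F v)
  exact TensorProduct.smul_tmul z s m

theorem indE_ind (P : IndMod F v M → Prop) (h0 : P 0) (hadd : ∀ a b, P a → P b → P (a + b))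
    (h : ∀ r m, P (indE F v M r m)) (z) : P z := by
  letI : Module (ZU F v) (RF F) := Module.compHom _ (zuF F v)
  letI : Module (ZU F v) M := Module.compHom _ (zuK F v)
  exact TensorProduct.induction_on (motive := P) z h0 h hadd

theorem zuF_of (w : Uv F v) : zuF F v (MonoidAlgebra.of ℤ (Uv F v) w : MonoidAlgebra ℤ (Uv F v))
    = cls F (uvToUnits F v w) := by
  exact (MonoidAlgebra.mapDomain_single).trans rfl

theorem zuK_of (w : Uv F v) : zuK F v (MonoidAlgebra.of ℤ (Uv F v) w : MonoidAlgebra ℤ (Uv F v))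
    = cls _ (uvToResUnits F v w) := by
  exact (MonoidAlgebra.mapDomain_single).trans rfl

theorem indE_bal' (w : Uv F v) (s : RF F) (m : M) :
    indE F v M (cls F (uvToUnits F v w) * s) m
      = indE F v M s (cls _ (uvToResUnits F v w) • m) := by
  have := indE_bal F v M (MonoidAlgebra.of ℤ (Uv F v) w : MonoidAlgebra ℤ (Uv F v)) s m
  rwa [zuF_of, zuK_of] at this

theorem ind_lift (X : Type) [AddCommGroup X] (f : RF F →+ M →+ X)
    (hf : ∀ w s m, f (cls F (uvToUnits F v w) * s) m = f s (cls _ (uvToResUnits F v w) • m)) :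
    ∃ g : IndMod F v M →+ X, ∀ r m, g (indE F v M r m) = f r m := by
  letI : Module (ZU F v) (RF F) := Module.compHom _ (zuF F v)
  letI : Module (ZU F v) M := Module.compHom _ (zuK F v)
  have hb : ∀ (z : ZU F v) (s : RF F) (m : M), f (zuF F v z * s) m = f s (zuK F v z • m) := by
    intro z s m
    refine kv_MA_ind (G := Uv F v)
      (fun z : ZU F v => f (zuF F v z * s) m = f s (zuK F v z • m)) ?_ ?_ ?_ ?_ z
    · exact (by simp : f (zuF F v 0 * s) m = f s (zuK F v 0 • m))
    · intro a b ha hb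
      have h1 : zuF F v (a + b) = zuF F v a + zuF F v b := map_add (zuF F v) a b
      have h2 : zuK F v (a + b) = zuK F v a + zuK F v b := map_add (zuK F v) a b
      show f (zuF F v (a + b) * s) m = f s (zuK F v (a + b) • m)
      rw [h1, h2, add_mul, map_add, add_smul, map_add, AddMonoidHom.add_apply, ha, hb]
    · intro a ha
      have h1 : zuF F v (-a) = -zuF F v a := map_neg (zuF F v) a
      have h2 : zuK F v (-a) = -zuK F v a := map_neg (zuK F v) a
      show f (zuF F v (-a) * s) m = f s (zuK F v (-a) • m)
      rw [h1, h2, neg_mul, map_neg, neg_smul, map_neg, AddMonoidHom.neg_apply, ha]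
    · intro w
      show f (zuF F v _ * s) m = f s (zuK F v _ • m)
      rw [zuF_of, zuK_of]
      exact hf w s m
  exact ⟨TensorProduct.liftAddHom f hb, fun r m => rfl⟩

theorem ind_bij (h : Function.Bijective (fun z : M => z + z)) :
    Function.Bijective (fun z : IndMod F v M => z + z) := by
  let d : M ≃+ M := AddEquiv.ofBijective
    (AddMonoidHom.mk' (fun z : M => z + z) (fun a b => by abel)) h
  have hd : ∀ z, d z = z + z := fun z => rfl
  have hds : ∀ (r : RF (Resk F v)) z, d.symm (r • z) = r • d.symm z := by
    intro r z
    apply d.injective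
    rw [AddEquiv.apply_symm_apply, hd, ← smul_add, ← hd, AddEquiv.apply_symm_apply]
  let f : RF F →+ M →+ IndMod F v M := AddMonoidHom.mk' (fun r => AddMonoidHom.mk'
    (fun m => indE F v M r (d.symm m)) (fun a b => by rw [map_add, indE_add_right]))
    (fun a b => by ext m; exact indE_add_left F v M a b (d.symm m))
  have hfa : ∀ r m, f r m = indE F v M r (d.symm m) := fun r m => rfl
  obtain ⟨g, hg⟩ := ind_lift F v M (IndMod F v M) f (by
      intro w s m
      rw [hfa, hfa, hds, indE_bal'])
  have key : ∀ z, g z + g z = z := by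
    refine indE_ind F v M _ ?_ ?_ ?_
    · simp
    · intro a b ha hb
      rw [map_add]
      nth_rewrite 3 [← ha]
      nth_rewrite 3 [← hb]
      abel
    · intro r m
      rw [hg, hfa, ← indE_add_right, ← hd, AddEquiv.apply_symm_apply]
  constructor
  · have : Function.LeftInverse g (fun z : IndMod F v M => z + z) := by
      intro z
      show g (z + z) = z
      rw [map_add, key]
    exact this.injective
  · exact fun z => ⟨g z, key z⟩

theorem kv_T (χ : SqCl F →* ℤˣ) (hχ : ∀ w, χ (sqc F (uvToUnits F v w)) = 1)
    (X : Type) [AddCommGroup X] (h2 : Function.Bijective (fun z : X => z + z))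
    (θ : M →+ X) (hθ : ∀ (a : (Resk F v)ˣ) m, θ (cls (Resk F v) a • m) = θ m) :
    ∃ T : ChiQuot F χ (IndMod F v (Loc2 (Resk F v) M)) →+ X,
      ∀ r m, T (mkChi F χ (indE F v _ r (toLoc2 (Resk F v) m))) = chiRF F χ r • θ m := by
  letI : Module (RF (Resk F v)) X := Module.compHom _ (augRF (Resk F v))
  have hX : ∀ (r : RF (Resk F v)) (x : X), r • x = augRF _ r • x := fun r x => rfl
  let θ1 : M →ₗ[RF (Resk F v)] X :=
    { θ with
      map_smul' := by
        intro r m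
        show θ (r • m) = r • θ m
        rw [hX]
        refine kv_RF_ind _ (fun r => θ (r • m) = augRF _ r • θ m) ?_ ?_ ?_ ?_ r
        · simp
        · intro a b ha hb
          rw [add_smul, map_add, map_add, add_smul, ha, hb]
        · intro a ha
          rw [neg_smul, map_neg, map_neg, neg_smul, ha]
        · intro a
          rw [hθ, augRF_cls, one_smul] }
  obtain ⟨θ2, hθ2⟩ : ∃ θ2 : Loc2 (Resk F v) M →ₗ[RF (Resk F v)] X, ∀ m, θ2 (toLoc2 (Resk F v) m) = θ m :=
    kv_loc_lift h2 θ1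
  let f : RF F →+ Loc2 (Resk F v) M →+ X := AddMonoidHom.mk' (fun r => AddMonoidHom.mk'
    (fun m => chiRF F χ r • θ2 m) (fun a b => by rw [map_add, smul_add]))
    (fun a b => by
      ext m
      show chiRF F χ (a + b) • θ2 m = chiRF F χ a • θ2 m + chiRF F χ b • θ2 m
      rw [map_add, add_smul])
  have hfa : ∀ r m, f r m = chiRF F χ r • θ2 m := fun r m => rfl
  obtain ⟨g, hg⟩ := ind_lift F v (Loc2 (Resk F v) M) X f (by
      intro w s m
      rw [hfa, hfa, map_mul, chiRF_cls, hχ, map_smul, hX, augRF_cls]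
      simp)
  obtain ⟨T, hT⟩ := kv_chi_lift F χ _ X g (by
    intro a z
    refine indE_ind F v _ (fun z => g (cls F a • z) = ((χ (sqc F a) : ℤˣ) : ℤ) • g z) ?_ ?_ ?_ z
    · simp
    · intro x y hx hy
      rw [smul_add, map_add, map_add, hx, hy, smul_add]
    · intro r m
      rw [smul_indE, hg, hg, hfa, hfa, map_mul, chiRF_cls, mul_smul])
  refine ⟨T, fun r m => ?_⟩
  rw [hT, hg, hfa, hθ2]

theorem uvRes_surj (u : (Resk F v)ˣ) : ∃ w, uvToResUnits F v w = u := by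
  obtain ⟨x, hx⟩ := IsLocalRing.residue_surjective (R := ↥v.valuationSubring) (u : Resk F v)
  have hu : IsUnit x := by
    by_contra h
    have := (IsLocalRing.residue_eq_zero_iff x).mpr h
    exact u.ne_zero (hx.symm.trans this)
  obtain ⟨w, rfl⟩ := hu
  exact ⟨w, Units.ext hx⟩

theorem kv_ind_ext (χ : SqCl F →* ℤˣ) (hχ : ∀ w, χ (sqc F (uvToUnits F v w)) = 1)
    (X : Type) [AddCommGroup X] (h2 : ∀ z : X, z + z = 0 → z = 0)
    (S : Set M) (hS : Submodule.span (RF (Resk F v)) S = ⊤)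
    (f g : ChiQuot F χ (IndMod F v (Loc2 (Resk F v) M)) →+ X)
    (h : ∀ m ∈ S, f (mkChi F χ (indE F v _ 1 (toLoc2 (Resk F v) m)))
      = g (mkChi F χ (indE F v _ 1 (toLoc2 (Resk F v) m)))) (z) : f z = g z := by
  let i1 : Loc2 (Resk F v) M →+ ChiQuot F χ (IndMod F v (Loc2 (Resk F v) M)) :=
    AddMonoidHom.mk' (fun m => mkChiHom F χ _ (indE F v _ 1 m)) (fun a b => by
      rw [indE_add_right, map_add])
  have hi1 : ∀ m, i1 m = mkChiHom F χ _ (indE F v _ 1 m) := fun m => rfl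
  have hcl : ∀ (a : (Resk F v)ˣ) m, i1 (cls (Resk F v) a • m) = i1 m := by
    intro a m
    obtain ⟨w, rfl⟩ := uvRes_surj F v a
    rw [hi1, hi1, ← indE_bal', ← smul_indE, map_smul, kv_chi_cls, hχ]
    simp
  have hsm : ∀ (r : RF (Resk F v)) m, i1 (r • m) = augRF _ r • i1 m := by
    intro r m
    refine kv_RF_ind _ (fun r => i1 (r • m) = augRF _ r • i1 m) ?_ ?_ ?_ ?_ r
    · simp
    · intro a b ha hb
      rw [add_smul, map_add, map_add, add_smul, ha, hb]
    · intro a ha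
      rw [neg_smul, map_neg, map_neg, neg_smul, ha]
    · intro a
      rw [hcl, augRF_cls, one_smul]
  have h1 : ∀ m, f (i1 m) = g (i1 m) := by
    refine kv_loc2_ext _ M X h2 (f.comp i1) (g.comp i1) ?_
    intro m
    show f (i1 (toLoc2Hom _ M m)) = g (i1 (toLoc2Hom _ M m))
    have hp : m ∈ Submodule.span (RF (Resk F v)) S := by rw [hS]; trivial
    induction hp using Submodule.span_induction with
    | mem x hx => exact h x hx
    | zero => simp only [map_zero]
    | add x y _ _ hx hy => simp only [map_add, hx, hy]
    | smul r x _ hx => simp only [map_smul, hsm, map_zsmul, hx]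
  obtain ⟨z, rfl⟩ := mkChi_surj F χ _ z
  refine indE_ind F v _ (fun z => f (mkChiHom F χ _ z) = g (mkChiHom F χ _ z)) ?_ ?_ ?_ z
  · simp only [map_zero]
  · intro a b ha hb
    simp only [map_add, ha, hb]
  · intro r m
    have : indE F v (Loc2 (Resk F v) M) r m = r • indE F v (Loc2 (Resk F v) M) 1 m := by
      rw [smul_indE, mul_one]
    rw [this, map_smul, kv_chi_smul, map_zsmul, map_zsmul, ← hi1, h1]

end

section
variable (F : Type) [Field F] (v : Valuation F (WithZero (Multiplicative ℤ)))

theorem vzk_spec (x : Fˣ) :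
    v (x : F) = ((Multiplicative.ofAdd (-(vzk F v x)) : Multiplicative ℤ) : WithZero (Multiplicative ℤ)) := by
  unfold vzk
  rw [neg_neg, ofAdd_toAdd, WithZero.coe_unzero]

theorem vzk_pos (x : Fˣ) : 0 < vzk F v x ↔ v (x : F) < 1 := by
  rw [vzk_spec, ← WithZero.coe_one, WithZero.coe_lt_coe, ← ofAdd_zero, Multiplicative.ofAdd_lt]
  omega

theorem vzk_zero (x : Fˣ) : vzk F v x = 0 ↔ v (x : F) = 1 := by
  rw [vzk_spec, ← WithZero.coe_one, WithZero.coe_inj, ← ofAdd_zero, Multiplicative.ofAdd.injective.eq_iff]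
  omega

theorem chiVal_sqc (x : Fˣ) : chiVal F v (sqc F x) = (-1 : ℤˣ) ^ (vzk F v x) := rfl

theorem chiVal_unit (x : Fˣ) (hx : v (x : F) = 1) : chiVal F v (sqc F x) = 1 := by
  rw [chiVal_sqc, (vzk_zero F v x).mpr hx, zpow_zero]

theorem rp_one : rp F 1 = 0 :=
  (Submodule.Quotient.mk_eq_zero _).mpr (Submodule.subset_span (Or.inl (Or.inl (Or.inl rfl))))

theorem rp_inv (x : Fˣ) : rp F x⁻¹ + rp F x = 0 :=
  (Submodule.Quotient.mk_eq_zero _).mpr (Submodule.subset_span (Or.inr ⟨x, rfl⟩))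

theorem rp_five (x y : Fˣ) (hx : (x : F) ≠ 1) (hy : (y : F) ≠ 1) :
  rp F x - rp F y + cls F x • rp F (y * x⁻¹)
    - cls F (U F ((x : F)⁻¹ - 1) (inv_sub_one_ne hx)) •
        rp F (U F ((1 - (x : F)⁻¹) / (1 - (y : F)⁻¹))
          (div_ne_zero (one_sub_inv_ne hx) (one_sub_inv_ne hy)))
    + cls F (U F (1 - (x : F)) (one_sub_ne hx)) •
        rp F (U F ((1 - (x : F)) / (1 - (y : F)))
          (div_ne_zero (one_sub_ne hx) (one_sub_ne hy))) = 0 :=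
  (Submodule.Quotient.mk_eq_zero _).mpr (Submodule.subset_span
    (Or.inl (Or.inl (Or.inr ⟨x, y, hx, hy, rfl⟩))))

/-- generators of the F-side -/
noncomputable def kvb (x : Fˣ) : ChiQuot F (chiVal F v) (Loc2 F (RP' F)) :=
  mkChi F (chiVal F v) (toLoc2 F (rp F x))

theorem kvb_def (x : Fˣ) : kvb F v x = mkChiHom F (chiVal F v) _ (toLoc2Hom F _ (rp F x)) := rfl

theorem kvb_one : kvb F v 1 = 0 := by rw [kvb_def, rp_one, map_zero, map_zero]

theorem kvb_inv (x : Fˣ) : kvb F v x⁻¹ = - kvb F v x := by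
  rw [eq_neg_iff_add_eq_zero, kvb_def, kvb_def, ← map_add, ← map_add, rp_inv, map_zero, map_zero]

theorem kvb_five (x y : Fˣ) (hx : (x : F) ≠ 1) (hy : (y : F) ≠ 1) :
  kvb F v x - kvb F v y + ((chiVal F v (sqc F x) : ℤˣ) : ℤ) • kvb F v (y * x⁻¹)
    - ((chiVal F v (sqc F (U F ((x : F)⁻¹ - 1) (inv_sub_one_ne hx))) : ℤˣ) : ℤ) •
        kvb F v (U F ((1 - (x : F)⁻¹) / (1 - (y : F)⁻¹))
          (div_ne_zero (one_sub_inv_ne hx) (one_sub_inv_ne hy)))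
    + ((chiVal F v (sqc F (U F (1 - (x : F)) (one_sub_ne hx))) : ℤˣ) : ℤ) •
        kvb F v (U F ((1 - (x : F)) / (1 - (y : F)))
          (div_ne_zero (one_sub_ne hx) (one_sub_ne hy))) = 0 := by
  have := congrArg (fun z => mkChiHom F (chiVal F v) _ (toLoc2Hom F _ z)) (rp_five F x y hx hy)
  simp only [map_add, map_sub, map_smul, map_zero, kv_chi_cls] at this
  exact this

theorem kv_Fside (hsurj : Function.Surjective v) :
    ∃ c : ChiQuot F (chiVal F v) (Loc2 F (RP' F)),
      (∀ (u : Fˣ) (hu : (u : F) ≠ 1), kvb F v u + kvb F v (U F (1 - (u : F)) (one_sub_ne hu)) = c) ∧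
      (∀ u : Fˣ, v (u : F) < 1 → kvb F v u = c) ∧
      (∀ u : Fˣ, v ((u : F) - 1) < 1 → kvb F v u = 0) ∧ (3 : ℤ) • c = 0 := by
  have hU : ∀ (x : F) (h : x ≠ 0), ((U F x h : Fˣ) : F) = x := fun x h => rfl
  let ord : F → ℤ := fun x => if h : x ≠ 0 then vzk F v (U F x h) else 0
  let s : F → ℤ := fun x => if h : x ≠ 0 then ((chiVal F v (sqc F (U F x h)) : ℤˣ) : ℤ) else 0
  let B : F → ChiQuot F (chiVal F v) (Loc2 F (RP' F)) :=
    fun x => if h : x ≠ 0 then kvb F v (U F x h) else 0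
  have ho : ∀ x (h : x ≠ 0), ord x = vzk F v (U F x h) := fun x h => dif_pos h
  have hs : ∀ x (h : x ≠ 0), s x = ((chiVal F v (sqc F (U F x h)) : ℤˣ) : ℤ) := fun x h => dif_pos h
  have hB : ∀ x (h : x ≠ 0), B x = kvb F v (U F x h) := fun x h => dif_pos h
  obtain ⟨pi, hpi⟩ := hsurj ((Multiplicative.ofAdd (-1) : Multiplicative ℤ) : WithZero (Multiplicative ℤ))
  have hpi0 : pi ≠ 0 := by
    rintro rfl
    rw [map_zero] at hpi
    exact WithZero.coe_ne_zero hpi.symm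
  obtain ⟨c, h1, h2, h3, h4⟩ := kv_key F ord (by
      intro x y hx hy
      rw [ho _ hx, ho _ hy, ho _ (mul_ne_zero hx hy), ← vzk_mul]
      congr 1; exact Units.ext rfl)
    (by
      intro x hx hx0
      rw [ho _ hx, vzk_pos, hU] at hx0
      have h1 : v (1 - x) = 1 := by
        rw [Valuation.map_sub_eq_of_lt_left, map_one]
        rwa [map_one]
      have h2 : 1 - x ≠ 0 := by
        intro h; rw [h, map_zero] at h1; exact zero_ne_one h1
      refine ⟨?_, h2⟩
      rw [ho _ h2, vzk_zero, hU, h1])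
    pi hpi0 (by
      have := vzk_spec F v (U F pi hpi0)
      rw [hU, hpi, WithZero.coe_inj, Multiplicative.ofAdd.injective.eq_iff] at this
      rw [ho _ hpi0]; omega)
    _ (kv_inj_of_bij (kv_chi_bij F (chiVal F v) _ (kv_loc2_bij F _)))
    s (by
      intro x hx h
      rw [ho _ hx] at h
      rw [hs _ hx, chiVal_sqc, Even.neg_one_zpow h]; rfl)
    (by
      intro x hx h
      rw [ho _ hx] at h
      rw [hs _ hx, chiVal_sqc, Odd.neg_one_zpow h]; rfl)
    B (by
      intro x hx
      rw [hB _ hx, hB _ (inv_ne_zero hx), ← kvb_inv]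
      congr 1; exact Units.ext rfl)
    (by
      rw [hB _ one_ne_zero]
      refine Eq.trans ?_ (kvb_one F v)
      congr 1; exact Units.ext rfl)
    (by
      intro x y hx hx1 hy hy1
      have := kvb_five F v (U F x hx) (U F y hy) hx1 hy1
      have e1 : (U F y hy) * (U F x hx)⁻¹ = U F (y / x) (div_ne_zero hy hx) := by
        apply Units.ext
        show y * x⁻¹ = y / x
        rw [div_eq_mul_inv]
      rw [e1] at this
      have n1 : x⁻¹ - 1 ≠ 0 := inv_sub_one_ne (x := U F x hx) hx1
      have n2 : 1 - x ≠ 0 := one_sub_ne (x := U F x hx) hx1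
      have n3 : 1 - y ≠ 0 := one_sub_ne (x := U F y hy) hy1
      have n4 : 1 - x⁻¹ ≠ 0 := one_sub_inv_ne (x := U F x hx) hx1
      have n5 : 1 - y⁻¹ ≠ 0 := one_sub_inv_ne (x := U F y hy) hy1
      rw [hB _ hx, hB _ hy, hB _ (div_ne_zero hy hx), hB _ (div_ne_zero n4 n5),
        hB _ (div_ne_zero n2 n3), hs _ hx, hs _ n1, hs _ n2]
      exact this)
  refine ⟨c, ?_, ?_, ?_, h4⟩
  · intro u hu
    have := h1 u u.ne_zero hu
    rw [hB _ u.ne_zero, hB _ (one_sub_ne hu)] at this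
    rw [← this]
    congr 2; exact Units.ext rfl
  · intro u hu
    have := h2 u u.ne_zero (by rw [ho _ u.ne_zero, vzk_pos]; exact hu)
    rw [hB _ u.ne_zero] at this
    rw [← this]
    congr 1; exact Units.ext rfl
  · intro u hu
    by_cases hu1 : (u : F) = 1
    · have hu2 : u = 1 := Units.ext hu1
      rw [hu2, kvb_one]
    · have n := one_sub_ne hu1
      have := h3 (1 - u) n (by
        rw [ho _ n, vzk_pos, hU, Valuation.map_sub_swap]; exact hu)
      rw [sub_sub_cancel, hB _ u.ne_zero] at this
      rw [← this]
      congr 1; exact Units.ext rfl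

theorem val_mem_max (a : ↥v.valuationSubring) :
    IsLocalRing.residue _ a = 0 ↔ v (a : F) < 1 := by
  rw [IsLocalRing.residue_eq_zero_iff, ValuationSubring.valuation_lt_one_iff]
  exact (v.isEquiv_valuation_valuationSubring.lt_one_iff_lt_one).symm

/-- `t` is the residue of `a` -/
def KRel (a : F) (t : Resk F v) : Prop :=
  ∃ h : a ∈ v.valuationSubring, IsLocalRing.residue ↥v.valuationSubring ⟨a, h⟩ = t

variable {F v}

theorem KRel.one : KRel F v 1 1 := ⟨one_mem _, map_one (IsLocalRing.residue ↥v.valuationSubring)⟩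

theorem KRel.sub {a b : F} {s t : Resk F v} (h : KRel F v a s) (h' : KRel F v b t) :
    KRel F v (a - b) (s - t) := by
  obtain ⟨h1, rfl⟩ := h
  obtain ⟨h2, rfl⟩ := h'
  exact ⟨sub_mem h1 h2, map_sub (IsLocalRing.residue ↥v.valuationSubring) ⟨a, h1⟩ ⟨b, h2⟩⟩

theorem KRel.mul {a b : F} {s t : Resk F v} (h : KRel F v a s) (h' : KRel F v b t) :
    KRel F v (a * b) (s * t) := by
  obtain ⟨h1, rfl⟩ := h
  obtain ⟨h2, rfl⟩ := h'
  exact ⟨mul_mem h1 h2, map_mul (IsLocalRing.residue ↥v.valuationSubring) ⟨a, h1⟩ ⟨b, h2⟩⟩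

theorem KRel.v1 {a : F} {t : Resk F v} (h : KRel F v a t) (ht : t ≠ 0) : v a = 1 := by
  obtain ⟨h1, rfl⟩ := h
  have h2 : ¬ v a < 1 := fun h => ht ((val_mem_max F v ⟨a, h1⟩).mpr h)
  exact le_antisymm ((Valuation.mem_valuationSubring_iff v a).mp h1) (not_lt.mp h2)

theorem KRel.lt {a b : F} {t : Resk F v} (h : KRel F v a t) (h' : KRel F v b t) :
    v (a - b) < 1 := by
  obtain ⟨h1, h2⟩ := h.sub h'
  exact (val_mem_max F v ⟨_, h1⟩).mp (h2.trans (sub_self t))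

theorem KRel.of_le {a : F} (h : v a ≤ 1) : ∃ t, KRel F v a t :=
  ⟨_, (Valuation.mem_valuationSubring_iff v a).mpr h, rfl⟩

theorem KRel.unique {a : F} {s t : Resk F v} (h : KRel F v a s) (h' : KRel F v a t) : s = t := by
  obtain ⟨h1, rfl⟩ := h
  obtain ⟨h2, rfl⟩ := h'
  rfl

theorem KRel.inv {a : F} {t : Resk F v} (h : KRel F v a t) (ht : t ≠ 0) :
    KRel F v a⁻¹ t⁻¹ := by
  have h1 := h.v1 ht
  obtain ⟨s, hs⟩ := KRel.of_le (F := F) (v := v) (a := a⁻¹) (by rw [map_inv₀, h1, inv_one])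
  have ha : a ≠ 0 := by
    rintro rfl
    rw [map_zero] at h1; exact zero_ne_one h1
  have h2 := h.mul hs
  rw [mul_inv_cancel₀ ha] at h2
  have h3 := h2.unique KRel.one
  rw [← eq_inv_of_mul_eq_one_right h3]
  exact hs

theorem KRel.div {a b : F} {s t : Resk F v} (h : KRel F v a s) (h' : KRel F v b t) (ht : t ≠ 0) :
    KRel F v (a / b) (s / t) := by
  rw [div_eq_mul_inv, div_eq_mul_inv]
  exact h.mul (h'.inv ht)

theorem KRel.surj (t : (Resk F v)ˣ) : ∃ a : Fˣ, KRel F v (a : F) (t : Resk F v) := by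
  obtain ⟨w, rfl⟩ := uvRes_surj F v t
  exact ⟨uvToUnits F v w, (w.val : ↥v.valuationSubring).2, rfl⟩

theorem KRel.res (x : Fˣ) (hx : v (x : F) = 1) : KRel F v (x : F) (resUnit F v x hx : Resk F v) :=
  ⟨(unitOfVal F v x hx).val.2, rfl⟩

theorem uvToUnits_val (w : Uv F v) : v (uvToUnits F v w : F) = 1 :=
  KRel.v1 (t := (uvToResUnits F v w : Resk F v)) ⟨(w.val : ↥v.valuationSubring).2, rfl⟩
    (Units.ne_zero _)

variable (F v)

theorem kv_e (hsurj : Function.Surjective v) :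
    ∃ (c : ChiQuot F (chiVal F v) (Loc2 F (RP' F)))
      (e : (Resk F v)ˣ → ChiQuot F (chiVal F v) (Loc2 F (RP' F))),
      e 1 = 0 ∧ (∀ u, e u⁻¹ = - e u) ∧
      (∀ (u : (Resk F v)ˣ) (hu : (u : Resk F v) ≠ 1),
        e u + e (U (Resk F v) (1 - (u : Resk F v)) (one_sub_ne hu)) = c) ∧
      (3 : ℤ) • c = 0 ∧
      (∀ (x y : (Resk F v)ˣ) (hx : (x : Resk F v) ≠ 1) (hy : (y : Resk F v) ≠ 1),
        e x - e y + e (y * x⁻¹)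
        - e (U (Resk F v) ((1 - (x : Resk F v)⁻¹) / (1 - (y : Resk F v)⁻¹))
            (div_ne_zero (one_sub_inv_ne hx) (one_sub_inv_ne hy)))
        + e (U (Resk F v) ((1 - (x : Resk F v)) / (1 - (y : Resk F v)))
            (div_ne_zero (one_sub_ne hx) (one_sub_ne hy))) = 0) ∧
      (∀ (x : Fˣ) (t : (Resk F v)ˣ), KRel F v (x : F) (t : Resk F v) → e t = kvb F v x) ∧
      (∀ x : Fˣ, v (x : F) < 1 → kvb F v x = c) := by
  obtain ⟨c, h1, h2, h3, h4⟩ := kv_Fside F v hsurj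
  have hone : ∀ a : F, KRel F v a 1 → v (a - 1) < 1 := fun a h => h.lt KRel.one
  have five : ∀ (X Y : Fˣ) (x y : (Resk F v)ˣ), KRel F v (X : F) (x : Resk F v) →
      KRel F v (Y : F) (y : Resk F v) → (x : Resk F v) ≠ 1 → (y : Resk F v) ≠ 1 →
      ∀ (hX : (X : F) ≠ 1) (hY : (Y : F) ≠ 1),
      kvb F v X - kvb F v Y + kvb F v (Y * X⁻¹)
        - kvb F v (U F ((1 - (X : F)⁻¹) / (1 - (Y : F)⁻¹))
          (div_ne_zero (one_sub_inv_ne hX) (one_sub_inv_ne hY)))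
        + kvb F v (U F ((1 - (X : F)) / (1 - (Y : F)))
          (div_ne_zero (one_sub_ne hX) (one_sub_ne hY))) = 0 := by
    intro X Y x y hXx hYy hx hy hX hY
    have := kvb_five F v X Y hX hY
    rw [chiVal_unit F v X (hXx.v1 x.ne_zero),
      chiVal_unit F v (U F ((X : F)⁻¹ - 1) (inv_sub_one_ne hX))
        (((hXx.inv x.ne_zero).sub KRel.one).v1 (inv_sub_one_ne hx)),
      chiVal_unit F v (U F (1 - (X : F)) (one_sub_ne hX))
        ((KRel.one.sub hXx).v1 (one_sub_ne hx))] at this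
    simpa only [Units.val_one, one_smul] using this
  have ne1 : ∀ (X : F) (x : Resk F v), KRel F v X x → x ≠ 1 → X ≠ 1 := by
    rintro X x h hx rfl
    exact hx (h.unique KRel.one)
  have wd : ∀ (X Y : Fˣ) (x : (Resk F v)ˣ), KRel F v (X : F) (x : Resk F v) →
      KRel F v (Y : F) (x : Resk F v) → kvb F v X = kvb F v Y := by
    intro X Y x hX hY
    by_cases hx : (x : Resk F v) = 1
    · rw [hx] at hX hY
      rw [h3 X (hone _ hX), h3 Y (hone _ hY)]
    · have f := five X Y x x hX hY hx hx (ne1 _ _ hX hx) (ne1 _ _ hY hx)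
      have r1 : KRel F v ((Y * X⁻¹ : Fˣ) : F) 1 := by
        have := hY.mul (hX.inv x.ne_zero)
        rw [mul_inv_cancel₀ x.ne_zero] at this
        simpa using this
      have r2 := (KRel.one.sub (hX.inv x.ne_zero)).div (KRel.one.sub (hY.inv x.ne_zero)) (one_sub_inv_ne hx)
      rw [div_self (one_sub_inv_ne hx)] at r2
      have r3 := (KRel.one.sub hX).div (KRel.one.sub hY) (one_sub_ne hx)
      rw [div_self (one_sub_ne hx)] at r3
      rw [h3 _ (hone _ r1), h3 (U F _ _) (hone _ r2), h3 (U F _ _) (hone _ r3)] at f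
      rw [← sub_eq_zero]
      simpa using f
  choose L hL using fun t : (Resk F v)ˣ => KRel.surj t
  have he : ∀ (x : Fˣ) (t : (Resk F v)ˣ), KRel F v (x : F) (t : Resk F v) →
      kvb F v (L t) = kvb F v x := fun x t h => wd _ _ t (hL t) h
  refine ⟨c, fun t => kvb F v (L t), ?_, ?_, ?_, h4, ?_, he, h2⟩
  · rw [← kvb_one F v]
    exact he 1 1 KRel.one
  · intro u
    rw [← kvb_inv]
    apply he
    have := (hL u).inv u.ne_zero
    simpa using this
  · intro u hu
    rw [← h1 (L u) (ne1 _ _ (hL u) hu)]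
    congr 1
    exact he _ _ (KRel.one.sub (hL u))
  · intro x y hx hy
    rw [← five (L x) (L y) x y (hL x) (hL y) hx hy (ne1 _ _ (hL x) hx) (ne1 _ _ (hL y) hy)]
    have e1 := he (L y * (L x)⁻¹) (y * x⁻¹) (by
      have := (hL y).mul ((hL x).inv x.ne_zero)
      simpa using this)
    have e2 := he (U F ((1 - (L x : F)⁻¹) / (1 - (L y : F)⁻¹))
      (div_ne_zero (one_sub_inv_ne (ne1 _ _ (hL x) hx)) (one_sub_inv_ne (ne1 _ _ (hL y) hy))))
      (U (Resk F v) ((1 - (x : Resk F v)⁻¹) / (1 - (y : Resk F v)⁻¹))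
            (div_ne_zero (one_sub_inv_ne hx) (one_sub_inv_ne hy)))
      ((KRel.one.sub ((hL x).inv x.ne_zero)).div (KRel.one.sub ((hL y).inv y.ne_zero))
        (one_sub_inv_ne hy))
    have e3 := he (U F ((1 - (L x : F)) / (1 - (L y : F)))
      (div_ne_zero (one_sub_ne (ne1 _ _ (hL x) hx)) (one_sub_ne (ne1 _ _ (hL y) hy))))
      (U (Resk F v) ((1 - (x : Resk F v)) / (1 - (y : Resk F v)))
            (div_ne_zero (one_sub_ne hx) (one_sub_ne hy)))
      ((KRel.one.sub (hL x)).div (KRel.one.sub (hL y)) (one_sub_ne hy))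
    beta_reduce
    rw [e1, e2, e3]

end

/-- Let `F` be a field with at least `4` elements and `v : F^× → ℤ` a
surjective discrete valuation with residue field `k`.  Then the specialization
homomorphism induces isomorphisms of `R_F`-modules
`(RP′(F)[1/2])_{χ_v} ≅ (Ind_F^k RP′(k)[1/2])_{χ_v} ≅ P(k)[1/2]{v}`:
(1) the map `σ_χ` induced on `χ_v`-coisotypic quotients by the specialization
homomorphism `σ` is bijective, and (2) there is an isomorphism `T` from
`(Ind_F^k RP′(k)[1/2])_{χ_v}` to `P(k)[1/2]{v}` which is `R_F`-semilinear for the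
twisted action (`T(⟨a⟩·z) = χ_v(a)·T(z)`) and carries the class of `⟨a⟩ ⊗ [u]` to
`χ_v(a)·[ū]`. -/
theorem statement9 (F : Type) [Field F] (hcard : 4 ≤ Cardinal.mk F)
    (v : Valuation F (WithZero (Multiplicative ℤ))) (hsurj : Function.Surjective v)
    (crk : RP'K (Resk F v))
    (hcrk : ∀ (u : (Resk F v)ˣ) (hu : (u : Resk F v) ≠ 1),
      crk = rpK _ u + rpK _ (U (Resk F v) (1 - (u : Resk F v)) (one_sub_ne hu)))
    (hcrk2 : Nat.card (Resk F v) = 2 → crk ≠ 0)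
    (σ : RP' F →ₗ[RF F] IndMod F v (Loc2 (Resk F v) (RP'K (Resk F v))))
    (hσ1 : ∀ (x : Fˣ) (hx : v (x : F) = 1),
      σ (rp F x) = indE F v _ 1 (toLoc2 (Resk F v) (rpK _ (resUnit F v x hx))))
    (hσpos : ∀ x : Fˣ, v (x : F) < 1 →
      σ (rp F x) = indE F v _ 1 (toLoc2 (Resk F v) crk))
    (hσneg : ∀ x : Fˣ, 1 < v (x : F) →
      σ (rp F x) = -indE F v _ 1 (toLoc2 (Resk F v) crk))
    (σχ : ChiQuot F (chiVal F v) (Loc2 F (RP' F)) →ₗ[RF F]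
      ChiQuot F (chiVal F v) (IndMod F v (Loc2 (Resk F v) (RP'K (Resk F v)))))
    (hσχ : ∀ z : RP' F,
      σχ (mkChi F (chiVal F v) (toLoc2 F z)) = mkChi F (chiVal F v) (σ z)) :
    Function.Bijective σχ ∧
      ∃ T : ChiQuot F (chiVal F v) (IndMod F v (Loc2 (Resk F v) (RP'K (Resk F v)))) ≃+
          LocalizedModule (Submonoid.powers (2 : ℤ)) (PBK (Resk F v)),
        (∀ (a : Fˣ) (z : IndMod F v (Loc2 (Resk F v) (RP'K (Resk F v)))),
          T (mkChi F (chiVal F v) (cls F a • z)) =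
            ((chiVal F v (sqc F a) : ℤˣ) : ℤ) • T (mkChi F (chiVal F v) z)) ∧
        ∀ (a : Fˣ) (u : (Resk F v)ˣ),
          T (mkChi F (chiVal F v)
              (indE F v _ (cls F a) (toLoc2 (Resk F v) (rpK _ u)))) =
            ((chiVal F v (sqc F a) : ℤˣ) : ℤ) • toLocZ _ (pbK' _ u) := by
  obtain ⟨θ, θcls, θrp, hspan, hlift, hext⟩ := kv_data (Resk F v) crk hcrk hcrk2
  obtain ⟨c, e, e1, ei, ec, c3, e5, eb, cb⟩ := kv_e F v hsurj
  have hMb := kv_chi_bij F (chiVal F v) (Loc2 F (RP' F)) (kv_loc2_bij F _)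
  have hIb := kv_chi_bij F (chiVal F v) (IndMod F v (Loc2 (Resk F v) (RP'K (Resk F v))))
    (ind_bij F v _ (kv_loc2_bij _ _))
  have hχ : ∀ w, chiVal F v (sqc F (uvToUnits F v w)) = 1 := fun w =>
    chiVal_unit F v _ (uvToUnits_val w)
  obtain ⟨S, hSe, hSc⟩ := hlift _ hMb e c e1 ei ec c3 e5
  obtain ⟨T, hT⟩ := kv_T F v (RP'K (Resk F v)) (chiVal F v) hχ
    (LocalizedModule (Submonoid.powers (2 : ℤ)) (PBK (Resk F v))) (kv_locZ_bij _) θ θcls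
  have hT1 : ∀ m, T (mkChi F (chiVal F v) (indE F v _ 1 (toLoc2 (Resk F v) m))) = θ m := by
    intro m
    rw [hT, map_one]
    exact one_zsmul _
  have hσb1 : ∀ (x : Fˣ) (hx : v (x : F) = 1), σχ (kvb F v x) =
      mkChi F (chiVal F v) (indE F v _ 1 (toLoc2 (Resk F v) (rpK _ (resUnit F v x hx)))) := by
    intro x hx
    rw [← hσ1 x hx]; exact hσχ _
  have hσbp : ∀ (x : Fˣ), v (x : F) < 1 → σχ (kvb F v x) =
      mkChi F (chiVal F v) (indE F v _ 1 (toLoc2 (Resk F v) crk)) := by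
    intro x hx
    rw [← hσpos x hx]; exact hσχ _
  -- first composite
  have hA : ∀ z, S (T (σχ z)) = z := by
    refine kv_F_ext F (chiVal F v) _ (kv_inj_of_bij hMb)
      ((S.comp T).comp σχ.toAddMonoidHom) (AddMonoidHom.id _) ?_
    intro x
    show S (T (σχ (kvb F v x))) = kvb F v x
    have hpos : ∀ x : Fˣ, v (x : F) < 1 → S (T (σχ (kvb F v x))) = kvb F v x := by
      intro x hx
      rw [hσbp x hx, hT1, hSc, cb x hx]
    rcases lt_trichotomy (v (x : F)) 1 with hx | hx | hx
    · exact hpos x hx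
    · rw [hσb1 x hx, hT1, θrp, hSe]
      exact eb x _ (KRel.res x hx)
    · have := hpos x⁻¹ (by
        rw [Units.val_inv_eq_inv_val, map_inv₀]
        exact inv_lt_one_of_one_lt₀ hx)
      rw [kvb_inv, map_neg, map_neg, map_neg] at this
      exact neg_injective this
  obtain ⟨pi, hpi⟩ : ∃ pi : Fˣ, v (pi : F) < 1 := by
    obtain ⟨pi, hpi⟩ := hsurj ((Multiplicative.ofAdd (-1) : Multiplicative ℤ) :
      WithZero (Multiplicative ℤ))
    have hpi0 : pi ≠ 0 := by
      rintro rfl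
      rw [map_zero] at hpi
      exact WithZero.coe_ne_zero hpi.symm
    refine ⟨U F pi hpi0, ?_⟩
    show v pi < 1
    rw [hpi, ← WithZero.coe_one, WithZero.coe_lt_coe, ← ofAdd_zero, Multiplicative.ofAdd_lt]
    omega
  have hσe : ∀ t, σχ (e t) =
      mkChi F (chiVal F v) (indE F v _ 1 (toLoc2 (Resk F v) (rpK _ t))) := by
    intro t
    obtain ⟨x, hx⟩ := KRel.surj t
    have hx1 := hx.v1 t.ne_zero
    have : resUnit F v x hx1 = t := Units.ext ((KRel.res x hx1).unique hx)
    rw [eb x t hx, hσb1 x hx1, this]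
  have hσc : σχ c = mkChi F (chiVal F v) (indE F v _ 1 (toLoc2 (Resk F v) crk)) := by
    rw [← cb pi hpi, hσbp pi hpi]
  have hB : ∀ z, σχ (S (T z)) = z := by
    refine kv_ind_ext F v _ (chiVal F v) hχ _ (kv_inj_of_bij hIb) _ hspan
      ((σχ.toAddMonoidHom.comp S).comp T) (AddMonoidHom.id _) ?_
    intro m hm
    show σχ (S (T (mkChi F (chiVal F v) (indE F v _ 1 (toLoc2 (Resk F v) m))))) = _
    rw [hT1]
    rcases hm with ⟨t, rfl⟩ | hm
    · rw [θrp, hSe, hσe]; rfl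
    · rw [Set.mem_singleton_iff] at hm
      subst hm
      rw [hSc, hσc]; rfl
  have hC : ∀ q, T (σχ (S q)) = q := by
    refine hext ((T.comp σχ.toAddMonoidHom).comp S) ?_ ?_
    · intro t
      show T (σχ (S (toLocZ _ (pbK' _ t)))) = _
      rw [hSe, hσe, hT1, θrp]
    · show T (σχ (S (θ crk))) = _
      rw [hSc, hσc, hT1]
  have hTb : Function.Bijective T :=
    ⟨Function.LeftInverse.injective (g := fun q => σχ (S q)) hB, fun q => ⟨_, hC q⟩⟩
  refine ⟨⟨Function.LeftInverse.injective (g := fun q => S (T q)) hA, fun z => ⟨_, hB z⟩⟩,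
    AddEquiv.ofBijective T hTb, ?_, ?_⟩
  · intro a z
    show T (mkChiHom F (chiVal F v) _ (cls F a • z)) = _ • T (mkChiHom F (chiVal F v) _ z)
    rw [map_smul, kv_chi_cls]
    rcases Int.units_eq_one_or (chiVal F v (sqc F a)) with h | h
    · rw [h]; simp
    · rw [h]; simp
  · intro a t
    show T (mkChi F (chiVal F v) (indE F v _ (cls F a) (toLoc2 (Resk F v) (rpK _ t)))) = _
    rw [hT, θrp, chiRF_cls]
end

section
/- Let F be a field with at least 4 elements and v : F^× → ℤ a surjective discrete valuation. Then [x]_{χ_v} = C_F in (RP′(F)[1/2])_{χ_v} for every x ∈ F^× with v(x) > 0. -/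
open scoped Classical

theorem core_lemma {F A : Type} [Field F] [AddCommGroup A] (V : F → ℤ) (e : F → ℤ) (g : F → A) (c : A)
    (h2 : ∀ m : A, m + m = 0 → m = 0)
    (he : ∀ x, Even (V x) → e x = 1) (ho : ∀ x, Odd (V x) → e x = -1)
    (hV : ∀ x y, x ≠ 0 → y ≠ 0 → V (x * y) = V x + V y)
    (hVn : ∀ x, V (-x) = V x) (hV1 : V 1 = 0)
    (hadd : ∀ x y, x ≠ 0 → y ≠ 0 → x + y ≠ 0 → min (V x) (V y) ≤ V (x + y))
    (p : F) (hp0 : p ≠ 0) (hp : V p = 1)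
    (hft : ∀ x y, x ≠ 0 → x ≠ 1 → y ≠ 0 → y ≠ 1 →
      g x - g y + e x • g (y / x) - e (x⁻¹ - 1) • g ((1 - x⁻¹) / (1 - y⁻¹))
        + e (1 - x) • g ((1 - x) / (1 - y)) = 0)
    (hinv : ∀ x, x ≠ 0 → g x⁻¹ = - g x)
    (hc : ∀ x, x ≠ 0 → x ≠ 1 → c = g x + g (1 - x))
    (x : F) (hx0 : x ≠ 0) (hx : 0 < V x) : g x = c := by
  have hVi : ∀ x, x ≠ 0 → V x⁻¹ = - V x := by
    intro x h
    have := hV x x⁻¹ h (inv_ne_zero h)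
    rw [mul_inv_cancel₀ h, hV1] at this
    omega
  have hVd : ∀ x y, x ≠ 0 → y ≠ 0 → V (x / y) = V x - V y := by
    intro x y h h'
    rw [div_eq_mul_inv, hV _ _ h (inv_ne_zero h'), hVi _ h']; ring
  have ne1 : ∀ x, V x ≠ 0 → x ≠ 1 := by
    rintro x h rfl; exact h hV1
  have sne : ∀ x, V x ≠ 0 → 1 - x ≠ 0 := fun x h h' => ne1 x h (by linear_combination -h')
  have Vpos : ∀ x, x ≠ 0 → 0 < V x → V (1 - x) = 0 := by
    intro x h0 h
    have hs := sne x (by omega)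
    have h1 := hadd 1 (-x) one_ne_zero (neg_ne_zero.2 h0) (by rwa [← sub_eq_add_neg])
    rw [hV1, hVn, ← sub_eq_add_neg] at h1
    have h3 := hadd (1 - x) x hs h0 (by simp)
    rw [sub_add_cancel, hV1] at h3
    omega
  have Vneg : ∀ x, x ≠ 0 → V x < 0 → V (1 - x) = V x := by
    intro x h0 h
    have h1 : 1 - x = -(x * (1 - x⁻¹)) := by field_simp; ring
    have h4 := hVi x h0
    rw [h1, hVn, hV _ _ h0 (sne _ (by omega)), Vpos _ (inv_ne_zero h0) (by omega)]; ring
  have E : ∀ x u, x ≠ 0 → x ≠ 1 → u ≠ 0 → u * x ≠ 1 →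
      g x - g (u * x) + e x • g u - e ((1 - x) / x) • g (u * ((1 - x) / (1 - u * x)))
        + e (1 - x) • g ((1 - x) / (1 - u * x)) = 0 := by
    intro x u h0 h1 hu h
    have := hft x (u * x) h0 h1 (mul_ne_zero hu h0) h
    have a1 : u * x / x = u := by field_simp
    have a2 : x⁻¹ - 1 = (1 - x) / x := by field_simp
    have b1 : 1 - u * x ≠ 0 := fun h' => h (by linear_combination -h')
    have b2 : u * x - 1 ≠ 0 := fun h' => h (by linear_combination h')
    have a3 : (1 - x⁻¹) / (1 - (u * x)⁻¹) = u * ((1 - x) / (1 - u * x)) := by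
      have t1 : 1 - (u*x)⁻¹ = -(1 - u * x) / (u * x) := by field_simp; ring
      have t2 : 1 - x⁻¹ = -(1 - x) / x := by field_simp; ring
      rw [t1, t2]
      field_simp
    rwa [a1, a2, a3] at this
  -- step 1
  have S1 : ∀ x, x ≠ 0 → 0 < V x → Odd (V x) → g x = c := by
    intro b hb0 hb hbo
    have hw0 := sne b (by omega)
    set w := 1 - b with hw
    have hbw : b = 1 - w := by rw [hw]; ring
    have hVw : V w = 0 := Vpos b hb0 hb
    have hpw0 : p * w ≠ 0 := mul_ne_zero hp0 hw0
    have hpw : V (p * w) = 1 := by rw [hV _ _ hp0 hw0]; omega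
    have d1 := Vpos (p * w) hpw0 (by omega)
    have d0 := sne (p * w) (by omega)
    have hx0 : b / (1 - p * w) ≠ 0 := div_ne_zero hb0 d0
    have hVx : V (b / (1 - p * w)) = V b := by rw [hVd _ _ hb0 d0]; omega
    set x := b / (1 - p * w) with hxd
    have hwx : (1 - x) / (1 - p * x) = w := by
      have n : 1 - p * x ≠ 0 := sne _ (by rw [hV _ _ hp0 hx0]; omega)
      rw [div_eq_iff n]
      have : x * (1 - p * w) = b := by rw [hxd]; field_simp
      rw [hbw] at this
      linear_combination -this
    have hx1 : x ≠ 1 := ne1 _ (by omega)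
    have hw1 : w ≠ 1 := by rw [hw]; intro h; exact hb0 (by linear_combination -h)
    have V1x : V (1 - x) = 0 := Vpos x hx0 (by omega)
    have n1x := sne x (by omega)
    have q1 := E x p hx0 hx1 hp0 (ne1 _ (by rw [hV _ _ hp0 hx0]; omega))
    rw [hwx, ho x (by rw [hVx]; exact hbo), he (1 - x) (by rw [V1x]; exact Even.zero),
      ho ((1 - x) / x) (by rw [hVd _ _ n1x hx0, V1x, hVx]; simpa using hbo)] at q1
    have q2 := E w p hw0 hw1 hp0 (ne1 _ (by omega))
    rw [← hbw, ← hxd, he w (by rw [hVw]; exact Even.zero), ho b hbo,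
      ho (b / w) (by rw [hVd _ _ hb0 hw0, hVw]; simpa using hbo)] at q2
    have q3 : g w = 0 := by
      apply h2
      have := congrArg₂ (· + ·) q1 q2
      simp only [neg_smul, one_smul, add_zero] at this
      rw [← this]; abel
    rw [hc b hb0 (ne1 _ (by omega)), ← hw, q3, add_zero]
  have S1n : ∀ x, x ≠ 0 → V x < 0 → Odd (V x) → g x = -c := by
    intro x h0 h h'
    have := hVi x h0
    rw [← S1 x⁻¹ (inv_ne_zero h0) (by omega) (by rw [this]; simpa using h'), hinv x h0, neg_neg]
  have hpi := hVi p hp0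
  have hpi0 := inv_ne_zero hp0
  have om : Odd (V p⁻¹) := by rw [hpi, hp]; decide
  have hVq : V (1 - p⁻¹) = V p⁻¹ := Vneg _ hpi0 (by omega)
  have hq0 : 1 - p⁻¹ ≠ 0 := sne _ (by omega)
  have c3 : c = -c + -c := by
    have := hc p⁻¹ hpi0 (ne1 _ (by omega))
    rwa [S1n _ hpi0 (by omega) om, S1n (1 - p⁻¹) hq0 (by omega) (hVq ▸ om)] at this
  rcases Int.even_or_odd (V x) with hev | hod
  swap
  · exact S1 x hx0 hx hod
  have hx2 : 2 ≤ V x := by obtain ⟨k, hk⟩ := hev; omega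
  have hxp0 : x * p⁻¹ ≠ 0 := mul_ne_zero hx0 hpi0
  have hxp : V (x * p⁻¹) = V x - 1 := by rw [hV _ _ hx0 hpi0]; omega
  have hxpo : Odd (V (x * p⁻¹)) := by rw [hxp]; exact hev.sub_odd odd_one
  have d0 := sne (x * p⁻¹) (by omega)
  have d1 := Vpos (x * p⁻¹) hxp0 (by omega)
  have hw0 : (1 - p⁻¹) / (1 - x * p⁻¹) ≠ 0 := div_ne_zero hq0 d0
  have hw : V ((1 - p⁻¹) / (1 - x * p⁻¹)) = -1 := by rw [hVd _ _ hq0 d0]; omega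
  have q := E p⁻¹ x hpi0 (ne1 _ (by omega)) hx0 (ne1 _ (by omega))
  have hxw : V (x * ((1 - p⁻¹) / (1 - x * p⁻¹))) = V x - 1 := by rw [hV _ _ hx0 hw0]; omega
  rw [S1n _ hpi0 (by omega) om, S1 _ hxp0 (by omega) hxpo, ho _ om,
    he ((1 - p⁻¹) / p⁻¹) (by rw [hVd _ _ hq0 hpi0, hVq, sub_self]; exact Even.zero),
    ho (1 - p⁻¹) (hVq ▸ om), S1n _ hw0 (by omega) (by rw [hw]; decide),
    S1 _ (mul_ne_zero hx0 hw0) (by omega) (by rw [hxw]; exact hev.sub_odd odd_one)] at q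
  simp only [neg_smul, one_smul] at q
  rw [c3, ← sub_eq_zero, ← neg_eq_zero, ← q]; abel

theorem chi_two_torsion (F : Type) [Field F] (χ : SqCl F →* ℤˣ) (M : Type) [AddCommGroup M]
    [Module (RF F) M] (m : Loc2 F M)
    (h : mkChi F χ m + mkChi F χ m = 0) : mkChi F χ m = 0 := by
  obtain ⟨half, hhalf⟩ : ∃ t : Loc2 F M →ₗ[RF F] Loc2 F M, ∀ n, t (n + n) = n := by
    have hu : IsUnit (algebraMap (RF F) (Module.End (RF F)
        (LocalizedModule (Submonoid.powers (2 : RF F)) M)) (2 : RF F)) :=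
      IsLocalizedModule.map_units (LocalizedModule.mkLinearMap (Submonoid.powers (2 : RF F)) M)
        ⟨2, Submonoid.mem_powers _⟩
    obtain ⟨b, hb⟩ := hu.exists_left_inv
    refine ⟨b, fun n => ?_⟩
    have h3 : ∀ n : LocalizedModule (Submonoid.powers (2 : RF F)) M, b (n + n) = n := by
      intro n
      have := congrArg (fun l : Module.End (RF F)
        (LocalizedModule (Submonoid.powers (2 : RF F)) M) => l n) hb
      simp only [Module.End.mul_apply, Module.algebraMap_end_apply, Module.End.one_apply,
        two_smul] at this
      exact this
    exact h3 n
  have hS : (chiSub F χ (Loc2 F M)).map half ≤ chiSub F χ (Loc2 F M) := by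
    unfold chiSub
    rw [Submodule.map_span_le]
    rintro _ ⟨a, n, rfl⟩
    apply Submodule.subset_span
    exact ⟨a, half n, by rw [map_sub, map_smul, map_zsmul]⟩
  have h1 : m + m ∈ chiSub F χ (Loc2 F M) :=
    (Submodule.Quotient.mk_eq_zero _).1 h
  have h2 := hS (Submodule.mem_map_of_mem h1)
  rw [hhalf] at h2
  exact (Submodule.Quotient.mk_eq_zero _).2 h2

theorem mkChi_cls (F : Type) [Field F] (χ : SqCl F →* ℤˣ) (M : Type) [AddCommGroup M]
    [Module (RF F) M] (a : Fˣ) (m : M) :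
    mkChi F χ (cls F a • m) = ((χ (sqc F a) : ℤˣ) : ℤ) • mkChi F χ m := by
  have : cls F a • m - ((χ (sqc F a) : ℤ)) • m ∈ chiSub F χ M :=
    Submodule.subset_span ⟨a, m, rfl⟩
  exact (Submodule.Quotient.eq _).2 this

/-- quotient map to `RP'` -/
noncomputable def piRP (F : Type) [Field F] : FreeRP F →ₗ[RF F] RP' F :=
  Submodule.mkQ (Submodule.span (RF F) ({gen F 1} ∪ ftRels F ∪ minusRels F ∪ invRels F))

/-- localization as a linear map -/
noncomputable def locMap (F : Type) [Field F] (M : Type) [AddCommGroup M] [Module (RF F) M] :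
    M →ₗ[RF F] Loc2 F M :=
  LocalizedModule.mkLinearMap (Submonoid.powers (2 : RF F)) M

/-- quotient map to the `χ`-quotient -/
noncomputable def chiMap (F : Type) [Field F] (χ : SqCl F →* ℤˣ) (M : Type) [AddCommGroup M]
    [Module (RF F) M] : M →ₗ[RF F] ChiQuot F χ M :=
  Submodule.mkQ (chiSub F χ M)

/-- the composite map -/
noncomputable def totMap (F : Type) [Field F] (χ : SqCl F →* ℤˣ) :
    FreeRP F →ₗ[RF F] ChiQuot F χ (Loc2 F (RP' F)) :=
  (chiMap F χ _).comp ((locMap F _).comp (piRP F))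

theorem totMap_smul (F : Type) [Field F] (χ : SqCl F →* ℤˣ) (a : Fˣ) (w : FreeRP F) :
    totMap F χ (cls F a • w) = ((χ (sqc F a) : ℤˣ) : ℤ) • totMap F χ w := by
  rw [map_smul]
  exact mkChi_cls F χ _ a (locMap F _ (piRP F w))

theorem totMap_rel (F : Type) [Field F] (χ : SqCl F →* ℤˣ) (w : FreeRP F)
    (hw : w ∈ ({gen F 1} ∪ ftRels F ∪ minusRels F ∪ invRels F : Set (FreeRP F))) :
    totMap F χ w = 0 := by
  have : piRP F w = 0 := (Submodule.Quotient.mk_eq_zero _).2 (Submodule.subset_span hw)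
  unfold totMap
  rw [LinearMap.comp_apply, LinearMap.comp_apply, this, map_zero, map_zero]

/-- Let `F` be a field with at least 4 elements and `v : F^× → ℤ` a
surjective discrete valuation.  Then `[x]_{χ_v} = C_F` in `(RP′(F)[1/2])_{χ_v}` for
every `x ∈ F^×` with `v(x) > 0`.  Here `C_F` is the common value of `[x] + [1-x]`
over `x ∈ F^× \ {1}`, and `χ_v(⟨a⟩) = (-1)^{v(a)}`. -/
theorem statement10 (F : Type) [Field F] (hcard : 4 ≤ Cardinal.mk F)
    (v : Fˣ → ℤ) (hmul : ∀ x y : Fˣ, v (x * y) = v x + v y)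
    (hsurj : Function.Surjective v)
    (hineq : ∀ (x y : Fˣ) (h : (x : F) + (y : F) ≠ 0),
      min (v x) (v y) ≤ v (U F ((x : F) + (y : F)) h))
    (c : RP' F)
    (hc : ∀ (x : Fˣ) (hx : (x : F) ≠ 1),
      c = rp F x + rp F (U F (1 - (x : F)) (one_sub_ne hx)))
    (x : Fˣ) (hx : 0 < v x) :
    mkChi F (chiV F v hmul) (toLoc2 F (rp F x) : Loc2 F (RP' F)) =
      mkChi F (chiV F v hmul) (toLoc2 F c) := by
  have v1 : v 1 = 0 := by
    have h1 := hmul 1 1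
    rw [mul_one] at h1; omega
  have vm1 : v (-1) = 0 := by
    have h1 := hmul (-1) (-1)
    rw [neg_mul_neg, mul_one] at h1; omega
  obtain ⟨p, hp⟩ := hsurj 1
  set χ := chiV F v hmul with hχ
  have hχa : ∀ a : Fˣ, χ (sqc F a) = (-1 : ℤˣ) ^ (v a) := fun a => rfl
  let V : F → ℤ := fun a => if h : a ≠ 0 then v (U F a h) else 0
  let e : F → ℤ := fun a => if h : a ≠ 0 then ((χ (sqc F (U F a h)) : ℤˣ) : ℤ) else 1
  let g : F → ChiQuot F χ (Loc2 F (RP' F)) :=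
    fun a => if h : a ≠ 0 then totMap F χ (gen F (U F a h)) else 0
  have V_def : ∀ a (h : a ≠ 0), V a = v (U F a h) := fun a h => dif_pos h
  have e_def : ∀ a (h : a ≠ 0), e a = ((χ (sqc F (U F a h)) : ℤˣ) : ℤ) := fun a h => dif_pos h
  have g_def : ∀ a (h : a ≠ 0), g a = totMap F χ (gen F (U F a h)) := fun a h => dif_pos h
  have U_val : ∀ a : Fˣ, U F (a : F) a.ne_zero = a := fun a => Units.ext rfl
  have hV : ∀ x y, x ≠ 0 → y ≠ 0 → V (x * y) = V x + V y := by
    intro x y hx hy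
    rw [V_def _ hx, V_def _ hy, V_def _ (mul_ne_zero hx hy), ← hmul]
    congr 1
    exact Units.ext rfl
  have key := core_lemma (F := F) V e g (mkChi F χ (toLoc2 F c))
    (fun m => by
      obtain ⟨n, rfl⟩ : ∃ n, mkChi F χ n = m := Submodule.Quotient.mk_surjective _ m
      exact chi_two_torsion F χ _ n)
    (fun a h => by
      by_cases h0 : a ≠ 0
      · rw [e_def a h0, hχa]
        rw [V_def a h0] at h
        rw [h.neg_one_zpow]; rfl
      · exact dif_neg h0)
    (fun a h => by
      by_cases h0 : a ≠ 0
      · rw [e_def a h0, hχa]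
        rw [V_def a h0] at h
        rw [h.neg_one_zpow]; rfl
      · exfalso
        have : V a = 0 := dif_neg h0
        rw [this] at h
        exact absurd h (by decide))
    hV
    (fun a => by
      by_cases h0 : a = 0
      · rw [h0, neg_zero]
      · have : V (-1) = 0 := by
          rw [V_def (-1) (neg_ne_zero.2 one_ne_zero), ← vm1]
          congr 1
          exact Units.ext rfl
        rw [neg_eq_neg_one_mul, hV _ _ (neg_ne_zero.2 one_ne_zero) h0, this, zero_add])
    (by
      rw [V_def 1 one_ne_zero, ← v1]
      congr 1
      exact Units.ext rfl)
    (fun a b ha hb hab => by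
      rw [V_def a ha, V_def b hb, V_def _ hab]
      exact hineq (U F a ha) (U F b hb) hab)
    (p : F) p.ne_zero (by rw [V_def _ p.ne_zero, U_val, hp])
    (fun a b ha ha1 hb hb1 => by
      have r := totMap_rel F χ (FT F (U F a ha) (U F b hb) ha1 hb1)
        (Or.inl (Or.inl (Or.inr ⟨_, _, _, _, rfl⟩)))
      unfold FT at r
      rw [map_add, map_sub, map_add, map_sub, totMap_smul, totMap_smul, totMap_smul] at r
      have n1 : b / a ≠ 0 := div_ne_zero hb ha
      have n2 : a⁻¹ - 1 ≠ 0 := inv_sub_one_ne (x := U F a ha) ha1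
      have n3 : 1 - a ≠ 0 := one_sub_ne (x := U F a ha) ha1
      have n4 : 1 - b ≠ 0 := one_sub_ne (x := U F b hb) hb1
      have n5 : 1 - a⁻¹ ≠ 0 := one_sub_inv_ne (x := U F a ha) ha1
      have n6 : 1 - b⁻¹ ≠ 0 := one_sub_inv_ne (x := U F b hb) hb1
      have n7 : U F b hb * (U F a ha)⁻¹ = U F (b / a) n1 :=
        Units.ext (by simp [U, div_eq_mul_inv])
      rw [n7] at r
      rw [g_def a ha, g_def b hb, g_def _ n1, g_def _ (div_ne_zero n5 n6),
        g_def _ (div_ne_zero n3 n4), e_def a ha, e_def _ n2, e_def _ n3]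
      exact r)
    (fun a ha => by
      have r := totMap_rel F χ (gen F (U F a ha)⁻¹ + gen F (U F a ha)) (Or.inr ⟨_, rfl⟩)
      rw [map_add] at r
      have n : (U F a ha)⁻¹ = U F a⁻¹ (inv_ne_zero ha) := Units.ext (by simp [U])
      rw [n] at r
      rw [g_def a ha, g_def _ (inv_ne_zero ha)]
      exact eq_neg_of_add_eq_zero_left r)
    (fun a ha ha1 => by
      have n : 1 - a ≠ 0 := one_sub_ne (x := U F a ha) ha1
      rw [g_def a ha, g_def _ n, ← map_add, hc (U F a ha) ha1]
      rfl)
    (x : F) x.ne_zero (by rw [V_def _ x.ne_zero, U_val]; exact hx)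
  rw [g_def _ x.ne_zero, U_val] at key
  exact key
end
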